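/- arXiv:1406.3419 — 2 statements merged into one kernel-verified Lean document; each statement's English description precedes it below -/
import Mathlib

section
/- There is an absolute constant C > 0 such that for every measurable function W on ℝ³ that is integrable on Ω = [0,2π)³ and satisfies ‖W χ_Ω‖_F < ∞, and every continuously differentiable compactly supported function ψ : ℝ³ → ℂ, one has ∫_Ω |ψ(x)|² |W(x)| dx ≤ C ‖W χ_Ω‖_F ∫_Ω |∇ψ(x)|² dx + C (∫_Ω |W(x)| dx)(∫_Ω |ψ(x)|² dx). -/
open MeasureTheory ENNReal NNReal Real Filter
open scoped Classical

noncomputable section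

abbrev E3 : Type := EuclideanSpace ℝ (Fin 3)

/-- The axis-parallel cube in `ℝ³` centered at `z` with side length `r`. -/
def cube3 (z : E3) (r : ℝ) : Set E3 := {x : E3 | ∀ i, |x i - z i| ≤ r / 2}

/-- The Kerman–Sawyer ratio for the cube `Q(z,r)`. -/
def ksRatio (w : E3 → ℝ≥0∞) (z : E3) (r : ℝ) : ℝ≥0∞ :=
  (∫⁻ x in cube3 z r, w x)⁻¹ *
    ∫⁻ x in cube3 z r, ∫⁻ y in cube3 z r, w x * w y / edist x y

/-- The Kerman–Sawyer norm `‖w‖_F` on `ℝ³`. -/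
def ksNorm (w : E3 → ℝ≥0∞) : ℝ≥0∞ :=
  ⨆ (z : E3) (r : ℝ) (_ : 0 < r), ksRatio w z r

/-- Fractional integral of order 1 on `ℝ³`: `I₁ f x = ∫ f y / |x-y|² dy`. -/
def I1 (f : E3 → ℝ≥0∞) (x : E3) : ℝ≥0∞ := ∫⁻ y, f y / (edist x y) ^ 2

/-- Fractional integral of order 2 on `ℝ³`: `I₂ f x = ∫ f y / |x-y| dy`. -/
def I2 (f : E3 → ℝ≥0∞) (x : E3) : ℝ≥0∞ := ∫⁻ y, f y / edist x y

/-- The fundamental cell `Ω = [0, 2π)³`. -/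
def Ω3 : Set E3 := {x : E3 | ∀ i, 0 ≤ x i ∧ x i < 2 * π}

/-- Periodicity with respect to the lattice `(2πℤ)³`. -/
def Periodic3 {α : Type*} (w : E3 → α) : Prop :=
  ∀ (x : E3) (n : Fin 3 → ℤ),
    w (x + (WithLp.equiv 2 (Fin 3 → ℝ)).symm (fun i => 2 * π * n i)) = w x

/-- The Kerman–Sawyer norm on the torus. -/
def ksNormT (w : E3 → ℝ≥0∞) : ℝ≥0∞ :=
  ⨆ (z : E3) (_ : z ∈ Ω3) (r : ℝ) (_ : 0 < r) (_ : r < 4 * π), ksRatio w z r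

/-- Euclidean norm of a vector in `Fin 3 → ℝ`. -/
def norm3 (v : Fin 3 → ℝ) : ℝ := Real.sqrt (∑ i, (v i) ^ 2)

/-- The character `e^{i n·x}`. -/
def ewave (n : Fin 3 → ℤ) (x : E3) : ℂ :=
  Complex.exp (Complex.I * ((∑ i, (n i : ℝ) * x i : ℝ) : ℂ))

/-- The real quadratic form `v A vᵀ`. -/
def qA (A : Matrix (Fin 3) (Fin 3) ℝ) (v : Fin 3 → ℝ) : ℝ := ∑ i, ∑ j, v i * A i j * v j

/-- Index of a dyadic subcube inside its parent. -/
def dyadicChild (n : Fin 3 → ℤ) (e : Fin 3 → Fin 2) : Fin 3 → ℤ := fun i => 2 * n i + (e i : ℕ)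

/-- Side length `2π / 2^k` of the dyadic cubes of generation `k`. -/
def dyadicSide (k : ℕ) : ℝ := 2 * π / 2 ^ k

lemma dyadicSide_pos (k : ℕ) : 0 < dyadicSide k := by unfold dyadicSide; positivity

lemma dyadicSide_succ (k : ℕ) : dyadicSide (k + 1) = dyadicSide k / 2 := by
  unfold dyadicSide; rw [pow_succ]; field_simp

/-- Sum of `φ` over the first `d` generations of the dyadic tree with root `(k, n)`. -/
def treeSum (φ : ℕ → (Fin 3 → ℤ) → ℝ) : ℕ → ℕ → (Fin 3 → ℤ) → ℝ
  | 0, _, _ => 0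
  | d + 1, k, n => φ k n + ∑ e, treeSum φ d (k + 1) (dyadicChild n e)

/-- A function of dyadic cubes is additive if its value is the sum over the eight children. -/
def DyadicAdditive (m : ℕ → (Fin 3 → ℤ) → ℝ) : Prop :=
  ∀ k n, m k n = ∑ e, m (k + 1) (dyadicChild n e)

lemma treeSum_nonneg {φ : ℕ → (Fin 3 → ℤ) → ℝ} (hφ : ∀ k n, 0 ≤ φ k n) (d k : ℕ)
    (n : Fin 3 → ℤ) : 0 ≤ treeSum φ d k n := by
  induction d generalizing k n with
  | zero => exact le_rfl
  | succ d ih => exact add_nonneg (hφ k n) (Finset.sum_nonneg fun e _ => ih _ _)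

lemma sum_sq_le_sq_sum_of_nonneg {ι : Type*} [Fintype ι] {g : ι → ℝ} (hg : ∀ i, 0 ≤ g i) :
    ∑ i, g i ^ 2 ≤ (∑ i, g i) ^ 2 := by
  rw [sq, Finset.sum_mul]
  refine Finset.sum_le_sum fun i _ => ?_
  rw [sq]
  exact mul_le_mul_of_nonneg_left (Finset.single_le_sum (fun j _ => hg j) (Finset.mem_univ i))
    (hg i)

/-- A superadditive energy dominates the dyadic energy. -/
lemma treeSum_sq_le_energy {m J : ℕ → (Fin 3 → ℤ) → ℝ}
    (hbase : ∀ k n, m k n ^ 2 / (2 * dyadicSide k) ≤ J k n)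
    (hstep : ∀ k n, ∑ e, J (k + 1) (dyadicChild n e) +
      (m k n ^ 2 - ∑ e, m (k + 1) (dyadicChild n e) ^ 2) / (2 * dyadicSide k) ≤ J k n)
    (d k : ℕ) (n : Fin 3 → ℤ) :
    treeSum (fun k n => m k n ^ 2 / dyadicSide k) d k n ≤
      4 * J k n - m k n ^ 2 / dyadicSide k := by
  induction d generalizing k n with
  | zero =>
    have h := hbase k n
    have h1 : m k n ^ 2 / (2 * dyadicSide k) = m k n ^ 2 / dyadicSide k / 2 := by
      rw [div_div, mul_comm]
    have h2 : 0 ≤ m k n ^ 2 / dyadicSide k := div_nonneg (sq_nonneg _) (dyadicSide_pos k).le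
    simp only [treeSum]
    linarith
  | succ d ih =>
    have hs := hstep k n
    have hl := dyadicSide_pos k
    have h := Finset.sum_le_sum fun e (_ : e ∈ Finset.univ) => ih (k + 1) (dyadicChild n e)
    rw [Finset.sum_sub_distrib, ← Finset.mul_sum, ← Finset.sum_div, dyadicSide_succ] at h
    simp only [treeSum]
    generalize ∑ e, m (k + 1) (dyadicChild n e) ^ 2 = M at *
    have e1 : M / (dyadicSide k / 2) = 2 * (M / dyadicSide k) := by field_simp
    have e2 : (m k n ^ 2 - M) / (2 * dyadicSide k) =
      (m k n ^ 2 / dyadicSide k - M / dyadicSide k) / 2 := by field_simp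
    rw [e1] at h
    rw [e2] at hs
    linarith

/-- Dyadic Carleson embedding, in the form of a Bellman function estimate. -/
lemma treeSum_carleson {m G H : ℕ → (Fin 3 → ℤ) → ℝ} {A : ℝ} (hA : 0 < A)
    (hm : DyadicAdditive m) (hG : DyadicAdditive G) (hH : DyadicAdditive H)
    (hm0 : ∀ k n, 0 ≤ m k n) (hH0 : ∀ k n, 0 ≤ H k n)
    (hGH : ∀ k n, G k n ^ 2 ≤ m k n * H k n)
    (hS : ∀ d k n, treeSum (fun k n => m k n ^ 2 / dyadicSide k) d k n ≤ A * m k n)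
    (d k : ℕ) (n : Fin 3 → ℤ) :
    treeSum (fun k n => G k n ^ 2 / dyadicSide k) d k n ≤
      4 * A * (H k n - A * (G k n ^ 2 /
        (A * m k n + treeSum (fun k n => m k n ^ 2 / dyadicSide k) d k n))) := by
  have hS0 : ∀ d k n, 0 ≤ treeSum (fun k n => m k n ^ 2 / dyadicSide k) d k n :=
    treeSum_nonneg fun k n => div_nonneg (sq_nonneg _) (dyadicSide_pos k).le
  have hGz : ∀ k n, m k n = 0 → G k n = 0 := by
    intro k n h
    have := hGH k n
    rw [h, zero_mul] at this
    exact pow_eq_zero_iff two_ne_zero |>.1 (le_antisymm this (sq_nonneg _))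
  induction d generalizing k n with
  | zero =>
    simp only [treeSum, add_zero]
    rcases (hm0 k n).eq_or_lt with h | h
    · have := hH0 k n
      rw [hGz k n h.symm]
      simp only [ne_eq, OfNat.ofNat_ne_zero, not_false_eq_true, zero_pow, zero_div, mul_zero,
        sub_zero]
      positivity
    · have h1 : A * (G k n ^ 2 / (A * m k n)) ≤ H k n := by
        rw [← mul_div_assoc, div_le_iff₀ (by positivity)]
        nlinarith [hGH k n]
      have : 0 ≤ H k n - A * (G k n ^ 2 / (A * m k n)) := by linarith
      positivity
  | succ d ih =>
    have h := Finset.sum_le_sum fun e (_ : e ∈ Finset.univ) => ih (k + 1) (dyadicChild n e)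
    have hl := dyadicSide_pos k
    have hSd := hS (d + 1) k n
    simp only [treeSum] at hSd ⊢
    rw [← Finset.mul_sum, Finset.sum_sub_distrib, ← Finset.mul_sum, ← hH k n] at h
    set D : (Fin 3 → Fin 2) → ℝ := fun e => A * m (k + 1) (dyadicChild n e) +
      treeSum (fun k n => m k n ^ 2 / dyadicSide k) d (k + 1) (dyadicChild n e) with hD
    have hD0 : ∀ e, 0 ≤ D e := fun e => by
      have := hm0 (k + 1) (dyadicChild n e)
      have := hS0 d (k + 1) (dyadicChild n e)
      simp only [hD]; positivity
    have hcs : G k n ^ 2 ≤ (∑ e, G (k + 1) (dyadicChild n e) ^ 2 / D e) * ∑ e, D e := by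
      rw [hG k n]
      refine Finset.sum_sq_le_sum_mul_sum_of_sq_le_mul _
        (fun e _ => div_nonneg (sq_nonneg _) (hD0 e)) (fun e _ => hD0 e) fun e _ => Eq.le ?_
      rcases (hD0 e).eq_or_lt with h0 | h0
      · have : m (k + 1) (dyadicChild n e) = 0 := by
          have h1 := hm0 (k + 1) (dyadicChild n e)
          have h2 := hS0 d (k + 1) (dyadicChild n e)
          simp only [hD] at h0
          nlinarith
        rw [hGz _ _ this, ← h0]; simp
      · field_simp
    have hDsum : ∑ e, D e = A * m k n +
        ∑ e, treeSum (fun k n => m k n ^ 2 / dyadicSide k) d (k + 1) (dyadicChild n e) := by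
      simp only [hD]
      rw [Finset.sum_add_distrib, ← Finset.mul_sum, ← hm k n]
    have hT0 : 0 ≤ ∑ e, treeSum (fun k n => m k n ^ 2 / dyadicSide k) d (k + 1) (dyadicChild n e) :=
      Finset.sum_nonneg fun e _ => hS0 _ _ _
    generalize ∑ e, treeSum (fun k n => m k n ^ 2 / dyadicSide k) d (k + 1)
      (dyadicChild n e) = T at *
    rw [hDsum] at hcs
    have hX0 : 0 ≤ ∑ e, G (k + 1) (dyadicChild n e) ^ 2 / D e :=
      Finset.sum_nonneg fun e _ => div_nonneg (sq_nonneg _) (hD0 e)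
    generalize ∑ e, G (k + 1) (dyadicChild n e) ^ 2 / D e = X at *
    rcases (hm0 k n).eq_or_lt with h0 | h0
    · have hX : 0 ≤ A * X := mul_nonneg hA.le hX0
      rw [hGz k n h0.symm]
      simp only [ne_eq, OfNat.ofNat_ne_zero, not_false_eq_true, zero_pow, zero_div, mul_zero,
        sub_zero, zero_add]
      nlinarith
    · set l := dyadicSide k
      have p1 : 0 < A * m k n + T := by positivity
      have p2 : 0 < A * m k n + (m k n ^ 2 / l + T) := by positivity
      have hX : G k n ^ 2 / (A * m k n + T) ≤ X := by rwa [div_le_iff₀ p1]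
      have key : G k n ^ 2 / l ≤ 4 * A * (A * (G k n ^ 2 / (A * m k n + T) -
          G k n ^ 2 / (A * m k n + (m k n ^ 2 / l + T)))) := by
        have e1 : G k n ^ 2 / (A * m k n + T) - G k n ^ 2 / (A * m k n + (m k n ^ 2 / l + T)) =
            G k n ^ 2 / l * (m k n ^ 2 / ((A * m k n + T) * (A * m k n + (m k n ^ 2 / l + T)))) := by
          rw [div_sub_div _ _ p1.ne' p2.ne', ← mul_div_assoc]
          congr 1
          field_simp
          ring
        have e2 : 1 ≤ 4 * A ^ 2 *
            (m k n ^ 2 / ((A * m k n + T) * (A * m k n + (m k n ^ 2 / l + T)))) := by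
          rw [← mul_div_assoc, le_div_iff₀ (by positivity), one_mul]
          have q1 : A * m k n + (m k n ^ 2 / l + T) ≤ 2 * (A * m k n) := by linarith
          have q2 : A * m k n + T ≤ 2 * (A * m k n) := by
            have : 0 ≤ m k n ^ 2 / l := by positivity
            linarith
          calc _ ≤ (2 * (A * m k n)) * (2 * (A * m k n)) := by gcongr
            _ = _ := by ring
        rw [e1]
        have := mul_le_mul_of_nonneg_left e2 (show 0 ≤ G k n ^ 2 / l by positivity)
        linarith
      have := mul_le_mul_of_nonneg_left hX (show 0 ≤ 4 * A * A by positivity)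
      linarith

lemma treeSum_bilinear_le {f F G : ℕ → (Fin 3 → ℤ) → ℝ} {a : ℝ} (ha : 0 < a)
    (hf : DyadicAdditive f) (hF : DyadicAdditive F) (hG : DyadicAdditive G)
    (hf0 : ∀ k n, 0 ≤ f k n) (hG0 : ∀ k n, 0 ≤ G k n)
    (hfF : ∀ k n, f k n ^ 2 ≤ dyadicSide k ^ 3 * F k n) (d k : ℕ) (n : Fin 3 → ℤ) :
    treeSum (fun k n => f k n * G k n / dyadicSide k ^ 2) d k n ≤
      2 * (f k n * G k n / dyadicSide k ^ 2) + a * (F k n - f k n ^ 2 / dyadicSide k ^ 3) +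
        2 / a * treeSum (fun k n => G k n ^ 2 / dyadicSide k) d k n := by
  induction d generalizing k n with
  | zero =>
    simp only [treeSum, mul_zero, add_zero]
    have hl := dyadicSide_pos k
    have h1 : f k n ^ 2 / dyadicSide k ^ 3 ≤ F k n := by
      rw [div_le_iff₀ (by positivity)]; linarith [hfF k n]
    have h2 : 0 ≤ a * (F k n - f k n ^ 2 / dyadicSide k ^ 3) := mul_nonneg ha.le (by linarith)
    have := hf0 k n
    have := hG0 k n
    positivity
  | succ d ih =>
    have h := Finset.sum_le_sum fun e (_ : e ∈ Finset.univ) => ih (k + 1) (dyadicChild n e)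
    have hl := dyadicSide_pos k
    simp only [treeSum]
    rw [Finset.sum_add_distrib, Finset.sum_add_distrib, ← Finset.mul_sum, ← Finset.mul_sum,
      ← Finset.mul_sum, Finset.sum_sub_distrib, ← hF k n, ← Finset.sum_div, ← Finset.sum_div,
      dyadicSide_succ] at h
    have hfk := hf k n
    have hGk := hG k n
    have hGsq := sum_sq_le_sq_sum_of_nonneg (fun e => hG0 (k + 1) (dyadicChild n e))
    rw [← hGk] at hGsq
    set l := dyadicSide k
    set f' := fun e => f (k + 1) (dyadicChild n e) with hf'
    set G' := fun e => G (k + 1) (dyadicChild n e) with hG'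
    have c8 : (Fintype.card (Fin 3 → Fin 2) : ℝ) = 8 := by simp
    have e1 : ∑ e, (f' e - f k n / 8) * G' e = ∑ e, f' e * G' e - f k n * G k n / 8 := by
      simp only [sub_mul, Finset.sum_sub_distrib]
      rw [← Finset.mul_sum, ← hGk]; ring
    have e2 : ∑ e, (f' e - f k n / 8) ^ 2 = ∑ e, f' e ^ 2 - f k n ^ 2 / 8 := by
      have : ∀ e, (f' e - f k n / 8) ^ 2 = f' e ^ 2 - (f k n / 4) * f' e + f k n ^ 2 / 64 := by
        intro e; ring
      simp only [this, Finset.sum_add_distrib, Finset.sum_sub_distrib]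
      rw [← Finset.mul_sum, ← hfk, Finset.sum_const, Finset.card_univ, nsmul_eq_mul, c8]; ring
    have key : 8 / l ^ 2 * ∑ e, (f' e - f k n / 8) * G' e ≤
        8 * a / l ^ 3 * ∑ e, (f' e - f k n / 8) ^ 2 + 2 / a / l * ∑ e, G' e ^ 2 := by
      rw [Finset.mul_sum, Finset.mul_sum, Finset.mul_sum, ← Finset.sum_add_distrib]
      refine Finset.sum_le_sum fun e _ => ?_
      have : 8 * a / l ^ 3 * (f' e - f k n / 8) ^ 2 + 2 / a / l * G' e ^ 2 -
          8 / l ^ 2 * ((f' e - f k n / 8) * G' e) =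
          2 / (a * l ^ 3) * (2 * a * (f' e - f k n / 8) - l * G' e) ^ 2 := by
        field_simp; ring
      have h2 : 0 ≤ 2 / (a * l ^ 3) * (2 * a * (f' e - f k n / 8) - l * G' e) ^ 2 := by positivity
      linarith
    have hG2 : 2 / a / l * ∑ e, G' e ^ 2 ≤ 2 / a / l * G k n ^ 2 := by gcongr
    rw [e1, e2] at key
    have i1 : (∑ e, f' e * G' e) / (l / 2) ^ 2 = 4 / l ^ 2 * ∑ e, f' e * G' e := by field_simp; ring
    have i2 : (∑ e, f' e ^ 2) / (l / 2) ^ 3 = 8 / l ^ 3 * ∑ e, f' e ^ 2 := by field_simp; ring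
    have i3 : 8 / l ^ 2 * (f k n * G k n / 8) = f k n * G k n / l ^ 2 := by field_simp
    have i4 : 8 * a / l ^ 3 * (f k n ^ 2 / 8) = a * (f k n ^ 2 / l ^ 3) := by field_simp
    have i5 : 2 / a / l * G k n ^ 2 = 2 / a * (G k n ^ 2 / l) := by field_simp
    have i6 : 8 * a / l ^ 3 * ∑ e, f' e ^ 2 = a * (8 / l ^ 3 * ∑ e, f' e ^ 2) := by ring
    have i7 : 2 * (4 / l ^ 2 * ∑ e, f' e * G' e) = 8 / l ^ 2 * ∑ e, f' e * G' e := by ring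
    rw [i1, i2] at h
    rw [mul_sub, mul_sub, i3, i4, i6] at key
    rw [i5] at hG2
    rw [i7] at h
    linarith

lemma le_treeSum_add_of_step {P B G : ℕ → (Fin 3 → ℤ) → ℝ} {ε c : ℝ} (hG : DyadicAdditive G)
    (hstep : ∀ k n, P k n ≤ ∑ e, P (k + 1) (dyadicChild n e) + c * B k n)
    (d k : ℕ) (n : Fin 3 → ℤ) (hbase : ∀ n, P (k + d) n ≤ ε * G (k + d) n) :
    P k n ≤ c * treeSum B d k n + ε * G k n := by
  induction d generalizing k n with
  | zero => simpa [treeSum] using hbase n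
  | succ d ih =>
    have hb : ∀ n, P (k + 1 + d) n ≤ ε * G (k + 1 + d) n := by
      rw [show k + 1 + d = k + (d + 1) by ring]; exact hbase
    have h := Finset.sum_le_sum fun e (_ : e ∈ Finset.univ) => ih (k + 1) (dyadicChild n e) hb
    rw [Finset.sum_add_distrib, ← Finset.mul_sum, ← Finset.mul_sum, ← hG k n] at h
    simp only [treeSum]
    linarith [hstep k n]

/-- Abstract dyadic trace inequality. -/
lemma dyadic_trace {m J f F G H P : ℕ → (Fin 3 → ℤ) → ℝ} {A : ℝ} (hA : 0 < A)
    (hm : DyadicAdditive m) (hG : DyadicAdditive G) (hH : DyadicAdditive H)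
    (hf : DyadicAdditive f) (hF : DyadicAdditive F)
    (hm0 : ∀ k n, 0 ≤ m k n) (hf0 : ∀ k n, 0 ≤ f k n) (hG0 : ∀ k n, 0 ≤ G k n)
    (hH0 : ∀ k n, 0 ≤ H k n)
    (hGH : ∀ k n, G k n ^ 2 ≤ m k n * H k n)
    (hfF : ∀ k n, f k n ^ 2 ≤ dyadicSide k ^ 3 * F k n)
    (hbase : ∀ k n, m k n ^ 2 / (2 * dyadicSide k) ≤ J k n)
    (hstep : ∀ k n, ∑ e, J (k + 1) (dyadicChild n e) +
      (m k n ^ 2 - ∑ e, m (k + 1) (dyadicChild n e) ^ 2) / (2 * dyadicSide k) ≤ J k n)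
    (hJ : ∀ k n, 4 * J k n ≤ A * m k n)
    (hP : ∀ k n, P k n ≤ ∑ e, P (k + 1) (dyadicChild n e) +
      8 * (f k n * G k n / dyadicSide k ^ 2))
    (hPlim : ∀ ε > 0, ∃ d, ∀ n, P d n ≤ ε * G d n) (n : Fin 3 → ℤ) (hPH : P 0 n = H 0 n) :
    H 0 n ≤ 3072 * A * F 0 n := by
  have hS : ∀ d k n, treeSum (fun k n => m k n ^ 2 / dyadicSide k) d k n ≤ A * m k n := by
    intro d k n
    have h1 := treeSum_sq_le_energy hbase hstep d k n
    have h2 : 0 ≤ m k n ^ 2 / dyadicSide k := div_nonneg (sq_nonneg _) (dyadicSide_pos k).le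
    linarith [hJ k n]
  have hR : ∀ d k n, treeSum (fun k n => G k n ^ 2 / dyadicSide k) d k n ≤ 4 * A * H k n := by
    intro d k n
    refine (treeSum_carleson hA hm hG hH hm0 hH0 hGH hS d k n).trans ?_
    have h0 := treeSum_nonneg (φ := fun k n => m k n ^ 2 / dyadicSide k)
      (fun k n => div_nonneg (sq_nonneg _) (dyadicSide_pos k).le) d k n
    have h1 := hm0 k n
    have : 0 ≤ A * (G k n ^ 2 / (A * m k n +
      treeSum (fun k n => m k n ^ 2 / dyadicSide k) d k n)) := by positivity
    gcongr
    linarith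
  have ha : 0 < 192 * A := by positivity
  have hl := dyadicSide_pos 0
  have hB : ∀ d, treeSum (fun k n => f k n * G k n / dyadicSide k ^ 2) d 0 n ≤
      192 * A * F 0 n + H 0 n / 16 := by
    intro d
    have h1 := treeSum_bilinear_le ha hf hF hG hf0 hG0 hfF d 0 n
    have h2 := hR d 0 n
    have h3 := hR 1 0 n
    simp only [treeSum, Finset.sum_const_zero, add_zero] at h3
    have h4 : 2 * (f 0 n * G 0 n / dyadicSide 0 ^ 2) ≤
        192 * A * (f 0 n ^ 2 / dyadicSide 0 ^ 3) + 1 / (192 * A) * (G 0 n ^ 2 / dyadicSide 0) := by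
      have : 192 * A * (f 0 n ^ 2 / dyadicSide 0 ^ 3) + 1 / (192 * A) * (G 0 n ^ 2 / dyadicSide 0)
          - 2 * (f 0 n * G 0 n / dyadicSide 0 ^ 2) =
          1 / (192 * A * dyadicSide 0 ^ 3) * (192 * A * f 0 n - dyadicSide 0 * G 0 n) ^ 2 := by
        field_simp; ring
      have h2 : 0 ≤ 1 / (192 * A * dyadicSide 0 ^ 3) *
          (192 * A * f 0 n - dyadicSide 0 * G 0 n) ^ 2 := by positivity
      linarith
    have h5 := mul_le_mul_of_nonneg_left h2 (show 0 ≤ 2 / (192 * A) by positivity)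
    have h6 := mul_le_mul_of_nonneg_left h3 (show 0 ≤ 1 / (192 * A) by positivity)
    have e5 : 2 / (192 * A) * (4 * A * H 0 n) = H 0 n / 24 := by field_simp; ring
    have e6 : 1 / (192 * A) * (4 * A * H 0 n) = H 0 n / 48 := by field_simp; ring
    rw [e5] at h5
    rw [e6] at h6
    linarith
  refine le_of_forall_pos_le_add fun η hη => ?_
  obtain ⟨d, hd⟩ := hPlim (η / (2 * (G 0 n + 1))) (by have := hG0 0 n; positivity)
  have h1 := le_treeSum_add_of_step hG hP d 0 n (by simpa using hd)
  have h2 : η / (2 * (G 0 n + 1)) * G 0 n ≤ η / 2 := by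
    have := hG0 0 n
    rw [div_mul_eq_mul_div, div_le_div_iff₀ (by positivity) (by positivity)]
    nlinarith
  linarith [hB d]

/-- Half-open dyadic cube of generation `k` with index `n`. -/
def dyadicBox (k : ℕ) (n : Fin 3 → ℤ) : Set E3 :=
  {x | ∀ i, (n i : ℝ) * dyadicSide k ≤ x i ∧ x i < ((n i : ℝ) + 1) * dyadicSide k}

lemma Ω3_eq_dyadicBox : Ω3 = dyadicBox 0 0 := by
  ext x; simp [Ω3, dyadicBox, dyadicSide]

lemma dyadicBox_eq_preimage (k : ℕ) (n : Fin 3 → ℤ) :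
    dyadicBox k n = (WithLp.ofLp : E3 → Fin 3 → ℝ) ⁻¹' (Set.univ.pi fun i =>
      Set.Ico ((n i : ℝ) * dyadicSide k) (((n i : ℝ) + 1) * dyadicSide k)) := by
  ext x; simp [dyadicBox, Set.mem_pi]

lemma measurableSet_dyadicBox (k : ℕ) (n : Fin 3 → ℤ) : MeasurableSet (dyadicBox k n) := by
  rw [dyadicBox_eq_preimage]
  exact (PiLp.volume_preserving_ofLp (Fin 3)).measurable
    (MeasurableSet.univ_pi fun i => measurableSet_Ico)

lemma volume_dyadicBox (k : ℕ) (n : Fin 3 → ℤ) :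
    volume (dyadicBox k n) = ENNReal.ofReal (dyadicSide k ^ 3) := by
  rw [dyadicBox_eq_preimage, (PiLp.volume_preserving_ofLp (Fin 3)).measure_preimage
    (MeasurableSet.univ_pi fun i => measurableSet_Ico).nullMeasurableSet, Real.volume_pi_Ico]
  have : ∀ i : Fin 3, ((n i : ℝ) + 1) * dyadicSide k - (n i : ℝ) * dyadicSide k = dyadicSide k :=
    fun i => by ring
  simp only [this, Finset.prod_const, Finset.card_univ, Fintype.card_fin]
  rw [ENNReal.ofReal_pow (dyadicSide_pos k).le]

lemma measureReal_dyadicBox (k : ℕ) (n : Fin 3 → ℤ) :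
    volume.real (dyadicBox k n) = dyadicSide k ^ 3 := by
  rw [Measure.real, volume_dyadicBox, ENNReal.toReal_ofReal (pow_pos (dyadicSide_pos k) 3).le]

instance isFiniteMeasure_restrict_dyadicBox (k : ℕ) (n : Fin 3 → ℤ) :
    IsFiniteMeasure ((volume : Measure E3).restrict (dyadicBox k n)) :=
  ⟨by rw [Measure.restrict_apply_univ, volume_dyadicBox]; exact ENNReal.ofReal_lt_top⟩

lemma floor_eq_of_mem_dyadicBox {k : ℕ} {n : Fin 3 → ℤ} {x : E3} :
    x ∈ dyadicBox k n ↔ ∀ i, ⌊x i / dyadicSide k⌋ = n i := by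
  have hl := dyadicSide_pos k
  simp only [dyadicBox, Set.mem_ofPred_eq, Int.floor_eq_iff, le_div_iff₀ hl, div_lt_iff₀ hl]

lemma dyadicBox_disjoint {k : ℕ} {n n' : Fin 3 → ℤ} (h : n ≠ n') :
    Disjoint (dyadicBox k n) (dyadicBox k n') := by
  rw [Set.disjoint_left]
  intro x hx hx'
  rw [floor_eq_of_mem_dyadicBox] at hx hx'
  exact h (funext fun i => (hx i).symm.trans (hx' i))

lemma dyadicChild_injective (n : Fin 3 → ℤ) : Function.Injective (dyadicChild n) := by
  intro e e' h
  ext i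
  have := congrFun h i
  simp only [dyadicChild] at this
  omega

lemma pairwise_disjoint_dyadicChild (k : ℕ) (n : Fin 3 → ℤ) :
    Pairwise (Function.onFun Disjoint fun e => dyadicBox (k + 1) (dyadicChild n e)) :=
  fun _ _ h => dyadicBox_disjoint fun h' => h (dyadicChild_injective n h')

lemma dyadicBox_child_subset (k : ℕ) (n : Fin 3 → ℤ) (e : Fin 3 → Fin 2) :
    dyadicBox (k + 1) (dyadicChild n e) ⊆ dyadicBox k n := by
  intro x hx i
  have hl := dyadicSide_pos k
  have h := hx i
  rw [dyadicSide_succ] at h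
  simp only [dyadicChild] at h
  have h2 : ((e i : ℕ) : ℝ) ≤ 1 := by
    have := (e i).isLt
    exact_mod_cast Nat.lt_succ_iff.1 this
  have h3 : (0 : ℝ) ≤ ((e i : ℕ) : ℝ) := Nat.cast_nonneg _
  push_cast at h
  constructor
  · nlinarith
  · nlinarith

lemma dyadicBox_eq_iUnion (k : ℕ) (n : Fin 3 → ℤ) :
    dyadicBox k n = ⋃ e, dyadicBox (k + 1) (dyadicChild n e) := by
  refine Set.Subset.antisymm (fun x hx => ?_)
    (Set.iUnion_subset fun e => dyadicBox_child_subset k n e)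
  have hl := dyadicSide_pos k
  rw [Set.mem_iUnion]
  refine ⟨fun i => if x i < ((n i : ℝ) + 1 / 2) * dyadicSide k then 0 else 1, fun i => ?_⟩
  have h := hx i
  simp only [dyadicChild, dyadicSide_succ]
  split_ifs with hi
  · push_cast
    constructor <;> simp <;> linarith
  · push_cast
    constructor <;> simp <;> linarith

lemma dist_le_of_mem_dyadicBox {k : ℕ} {n : Fin 3 → ℤ} {x y : E3} (hx : x ∈ dyadicBox k n)
    (hy : y ∈ dyadicBox k n) : dist x y ≤ 2 * dyadicSide k := by
  have hl := dyadicSide_pos k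
  rw [EuclideanSpace.dist_eq]
  refine Real.sqrt_le_iff.2 ⟨by positivity, ?_⟩
  have : ∀ i, dist (x i) (y i) ^ 2 ≤ dyadicSide k ^ 2 := fun i => by
    rw [Real.dist_eq, sq_abs]
    have h1 := hx i
    have h2 := hy i
    apply sq_le_sq'
    · linarith
    · linarith
  calc ∑ i, dist (x i) (y i) ^ 2 ≤ ∑ _i : Fin 3, dyadicSide k ^ 2 :=
        Finset.sum_le_sum fun i _ => this i
    _ = 3 * dyadicSide k ^ 2 := by simp
    _ ≤ _ := by nlinarith [sq_nonneg (dyadicSide k)]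

/-- The center of a dyadic cube. -/
def dyadicCenter (k : ℕ) (n : Fin 3 → ℤ) : E3 :=
  WithLp.toLp 2 fun i => ((n i : ℝ) + 1 / 2) * dyadicSide k

lemma dyadicBox_ae_eq_cube3 (k : ℕ) (n : Fin 3 → ℤ) :
    dyadicBox k n =ᵐ[volume] cube3 (dyadicCenter k n) (dyadicSide k) := by
  have h : cube3 (dyadicCenter k n) (dyadicSide k) = (WithLp.ofLp : E3 → Fin 3 → ℝ) ⁻¹'
      (Set.Icc (fun i => (n i : ℝ) * dyadicSide k) fun i => ((n i : ℝ) + 1) * dyadicSide k) := by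
    ext x
    simp only [cube3, dyadicCenter, Set.mem_ofPred_eq, Set.mem_preimage, Set.mem_Icc, Pi.le_def,
      abs_le, ← forall_and]
    refine forall_congr' fun i => ?_
    constructor <;> rintro ⟨h1, h2⟩ <;> constructor <;> linarith
  rw [h, dyadicBox_eq_preimage]
  exact (PiLp.volume_preserving_ofLp (Fin 3)).quasiMeasurePreserving.preimage_ae_eq
    Measure.univ_pi_Ico_ae_eq_Icc

lemma dyadicAdditive_setIntegral {μ : Measure E3} {g : E3 → ℝ}
    (hg : ∀ k n, IntegrableOn g (dyadicBox k n) μ) :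
    DyadicAdditive fun k n => ∫ x in dyadicBox k n, g x ∂μ := by
  intro k n
  simp only
  rw [dyadicBox_eq_iUnion k n, integral_iUnion_fintype (fun e => measurableSet_dyadicBox _ _)
    (pairwise_disjoint_dyadicChild k n) fun e => hg _ _]

lemma dyadicBox_child_shift (k : ℕ) (n : Fin 3 → ℤ) (e e' : Fin 3 → Fin 2) :
    ∃ v : E3, ‖v‖ ≤ 2 * dyadicSide (k + 1) ∧
      (fun x => x + v) ⁻¹' dyadicBox (k + 1) (dyadicChild n e') =
        dyadicBox (k + 1) (dyadicChild n e) ∧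
      ∀ x ∈ dyadicBox (k + 1) (dyadicChild n e), ∀ t ∈ Set.Icc (0 : ℝ) 1,
        x + t • v ∈ dyadicBox k n := by
  set v : E3 := WithLp.toLp 2 fun i => (((e' i : ℕ) : ℝ) - ((e i : ℕ) : ℝ)) * dyadicSide (k + 1)
    with hv
  have hvi : ∀ i, v i = (((e' i : ℕ) : ℝ) - ((e i : ℕ) : ℝ)) * dyadicSide (k + 1) := fun i => rfl
  have hl := dyadicSide_pos k
  have hl' := dyadicSide_pos (k + 1)
  have bd : ∀ (e : Fin 3 → Fin 2) i, 0 ≤ ((e i : ℕ) : ℝ) ∧ ((e i : ℕ) : ℝ) ≤ 1 := fun e i =>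
    ⟨Nat.cast_nonneg _, by exact_mod_cast Nat.lt_succ_iff.1 (e i).isLt⟩
  refine ⟨v, ?_, ?_, ?_⟩
  · rw [EuclideanSpace.norm_eq]
    refine Real.sqrt_le_iff.2 ⟨by positivity, ?_⟩
    have : ∀ i, ‖v i‖ ^ 2 ≤ dyadicSide (k + 1) ^ 2 := fun i => by
      rw [Real.norm_eq_abs, sq_abs, hvi, mul_pow]
      have := bd e i
      have := bd e' i
      refine mul_le_of_le_one_left (sq_nonneg _) ?_
      nlinarith
    calc ∑ i, ‖v i‖ ^ 2 ≤ ∑ _i : Fin 3, dyadicSide (k + 1) ^ 2 :=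
          Finset.sum_le_sum fun i _ => this i
      _ = 3 * dyadicSide (k + 1) ^ 2 := by simp
      _ ≤ _ := by nlinarith [sq_nonneg (dyadicSide (k + 1))]
  · ext x
    simp only [dyadicBox, Set.mem_preimage, Set.mem_ofPred_eq, PiLp.add_apply, hvi, dyadicChild]
    refine forall_congr' fun i => ?_
    push_cast
    constructor <;> rintro ⟨h1, h2⟩ <;> constructor <;> linarith
  · intro x hx t ht i
    have h := hx i
    have h1 := bd e i
    have h2 := bd e' i
    have e1 : (x + t • v) i = x i + t * v i := by simp
    rw [e1, hvi]
    rw [dyadicSide_succ] at h ⊢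
    simp only [dyadicChild] at h
    push_cast at h
    set l := dyadicSide k
    have h3 : 0 ≤ (1 - t) * ((e i : ℕ) : ℝ) * (l / 2) :=
      mul_nonneg (mul_nonneg (by linarith [ht.2]) h1.1) (by positivity)
    have h4 : 0 ≤ t * ((e' i : ℕ) : ℝ) * (l / 2) :=
      mul_nonneg (mul_nonneg ht.1 h2.1) (by positivity)
    have h5 : 0 ≤ (1 - t) * (1 - ((e i : ℕ) : ℝ)) * (l / 2) :=
      mul_nonneg (mul_nonneg (by linarith [ht.2]) (by linarith)) (by positivity)
    have h6 : 0 ≤ t * (1 - ((e' i : ℕ) : ℝ)) * (l / 2) :=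
      mul_nonneg (mul_nonneg ht.1 (by linarith)) (by positivity)
    constructor <;> linarith

/-- Mean value of `ψ` over a dyadic cube. -/
def dyadicAvg (ψ : E3 → ℂ) (k : ℕ) (n : Fin 3 → ℤ) : ℂ :=
  (dyadicSide k ^ 3)⁻¹ • ∫ x in dyadicBox k n, ψ x

lemma norm_sub_le_integral_fderiv {ψ : E3 → ℂ} (hψ : ContDiff ℝ 1 ψ) (x v : E3) :
    ‖ψ (x + v) - ψ x‖ ≤ ∫ t in Set.Icc (0 : ℝ) 1, ‖fderiv ℝ ψ (x + t • v)‖ * ‖v‖ := by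
  have hc : Continuous fun t : ℝ => fderiv ℝ ψ (x + t • v) :=
    (hψ.continuous_fderiv one_ne_zero).comp (by fun_prop)
  have hd : ∀ t : ℝ, HasDerivAt (fun t : ℝ => ψ (x + t • v)) (fderiv ℝ ψ (x + t • v) v) t := by
    intro t
    have h1 : HasDerivAt (fun t : ℝ => x + t • v) v t := by
      simpa using ((hasDerivAt_id t).smul_const v).const_add x
    exact ((hψ.differentiable one_ne_zero) (x + t • v)).hasFDerivAt.comp_hasDerivAt t h1
  have h := intervalIntegral.integral_eq_sub_of_hasDerivAt (a := 0) (b := 1)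
    (fun t _ => hd t) ((hc.clm_apply continuous_const).intervalIntegrable _ _)
  simp only [one_smul, zero_smul, add_zero] at h
  rw [← h, intervalIntegral.integral_of_le zero_le_one, ← integral_Icc_eq_integral_Ioc]
  refine norm_integral_le_of_norm_le ?_ (ae_of_all _ fun t => ContinuousLinearMap.le_opNorm _ _)
  exact (hc.norm.mul continuous_const).integrableOn_Icc

lemma norm_setIntegral_child_sub_le {ψ : E3 → ℂ} (hψ : ContDiff ℝ 1 ψ) (hs : HasCompactSupport ψ)
    (k : ℕ) (n : Fin 3 → ℤ) (e e' : Fin 3 → Fin 2) :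
    ‖(∫ x in dyadicBox (k + 1) (dyadicChild n e), ψ x) -
        ∫ x in dyadicBox (k + 1) (dyadicChild n e'), ψ x‖ ≤
      2 * dyadicSide (k + 1) * ∫ x in dyadicBox k n, ‖fderiv ℝ ψ x‖ := by
  obtain ⟨v, hv, hpre, hmem⟩ := dyadicBox_child_shift k n e e'
  have hDc : Continuous (fderiv ℝ ψ) := hψ.continuous_fderiv one_ne_zero
  obtain ⟨M, hM⟩ := (hs.fderiv (𝕜 := ℝ)).exists_bound_of_continuous hDc
  have hDint : Integrable (fun x => ‖fderiv ℝ ψ x‖) volume :=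
    (hDc.integrable_of_hasCompactSupport (hs.fderiv (𝕜 := ℝ))).norm
  have hψint : Integrable ψ volume := hψ.continuous.integrable_of_hasCompactSupport hs
  have hshift : ∀ u : E3, MeasurePreserving (fun x : E3 => x + u) volume volume :=
    fun u => measurePreserving_add_right volume u
  have hemb : ∀ u : E3, MeasurableEmbedding (fun x : E3 => x + u) :=
    fun u => (MeasurableEquiv.addRight u).measurableEmbedding
  set B := dyadicBox (k + 1) (dyadicChild n e) with hB
  have e1 : ∫ x in dyadicBox (k + 1) (dyadicChild n e'), ψ x = ∫ x in B, ψ (x + v) := by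
    rw [← (hshift v).setIntegral_preimage_emb (hemb v), hpre]
  rw [e1, ← integral_sub hψint.integrableOn (hψint.comp_add_right v).integrableOn]
  have hcont : Continuous fun p : E3 × ℝ => ‖fderiv ℝ ψ (p.1 + p.2 • v)‖ * ‖v‖ :=
    (hDc.comp (by fun_prop)).norm.mul continuous_const
  have hprod : Integrable (fun p : E3 × ℝ => ‖fderiv ℝ ψ (p.1 + p.2 • v)‖ * ‖v‖)
      ((volume.restrict B).prod (volume.restrict (Set.Icc (0 : ℝ) 1))) := by
    refine Integrable.of_bound hcont.aestronglyMeasurable (M * ‖v‖) (ae_of_all _ fun p => ?_)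
    rw [norm_mul, norm_norm, norm_norm]
    exact mul_le_mul_of_nonneg_right (hM _) (norm_nonneg _)
  calc _ ≤ ∫ x in B, ∫ t in Set.Icc (0 : ℝ) 1, ‖fderiv ℝ ψ (x + t • v)‖ * ‖v‖ := by
        refine norm_integral_le_of_norm_le hprod.integral_prod_left (ae_of_all _ fun x => ?_)
        rw [norm_sub_rev]
        exact norm_sub_le_integral_fderiv hψ x v
    _ = ∫ t in Set.Icc (0 : ℝ) 1, ∫ x in B, ‖fderiv ℝ ψ (x + t • v)‖ * ‖v‖ :=
        integral_integral_swap hprod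
    _ ≤ ∫ t in Set.Icc (0 : ℝ) 1, (∫ x in dyadicBox k n, ‖fderiv ℝ ψ x‖) * ‖v‖ := by
        refine setIntegral_mono_on hprod.integral_prod_right (integrable_const _)
          measurableSet_Icc fun t ht => ?_
        rw [integral_mul_const]
        refine mul_le_mul_of_nonneg_right ?_ (norm_nonneg _)
        have e2 : (fun x : E3 => x + t • v) ⁻¹' ((fun x : E3 => x + -(t • v)) ⁻¹' B) = B := by
          ext x; simp
        rw [← e2, (hshift (t • v)).setIntegral_preimage_emb (hemb (t • v))
          (fun x => ‖fderiv ℝ ψ x‖)]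
        refine setIntegral_mono_set hDint.integrableOn (ae_of_all _ fun x => norm_nonneg _)
          (LE.le.eventuallyLE fun x hx => ?_)
        have := hmem _ hx t ht
        simpa using this
    _ = (∫ x in dyadicBox k n, ‖fderiv ℝ ψ x‖) * ‖v‖ := by simp
    _ ≤ _ := by
        rw [mul_comm]
        exact mul_le_mul_of_nonneg_right hv (integral_nonneg fun x => norm_nonneg _)

lemma norm_dyadicAvg_child_sub_le {ψ : E3 → ℂ} (hψ : ContDiff ℝ 1 ψ) (hs : HasCompactSupport ψ)
    (k : ℕ) (n : Fin 3 → ℤ) (e : Fin 3 → Fin 2) :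
    ‖dyadicAvg ψ (k + 1) (dyadicChild n e) - dyadicAvg ψ k n‖ ≤
      8 * ((∫ x in dyadicBox k n, ‖fderiv ℝ ψ x‖) / dyadicSide k ^ 2) := by
  have hl := dyadicSide_pos k
  have hψint : Integrable ψ volume := hψ.continuous.integrable_of_hasCompactSupport hs
  have hsum : ∫ x in dyadicBox k n, ψ x =
      ∑ e', ∫ x in dyadicBox (k + 1) (dyadicChild n e'), ψ x := by
    rw [dyadicBox_eq_iUnion k n, integral_iUnion_fintype (fun e => measurableSet_dyadicBox _ _)
      (pairwise_disjoint_dyadicChild k n) fun e => hψint.integrableOn]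
  have e1 : dyadicAvg ψ (k + 1) (dyadicChild n e) - dyadicAvg ψ k n =
      (dyadicSide k ^ 3)⁻¹ • ∑ e', ((∫ x in dyadicBox (k + 1) (dyadicChild n e), ψ x) -
        ∫ x in dyadicBox (k + 1) (dyadicChild n e'), ψ x) := by
    rw [Finset.sum_sub_distrib, ← hsum, smul_sub, dyadicAvg, dyadicAvg, Finset.sum_const,
      Finset.card_univ, dyadicSide_succ, ← Nat.cast_smul_eq_nsmul ℝ, smul_smul]
    congr 2
    simp
    field_simp
    norm_num
  rw [e1, norm_smul, norm_inv, norm_pow, Real.norm_of_nonneg hl.le]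
  have h := (norm_sum_le Finset.univ fun e' =>
    (∫ x in dyadicBox (k + 1) (dyadicChild n e), ψ x) -
        ∫ x in dyadicBox (k + 1) (dyadicChild n e'), ψ x).trans
    (Finset.sum_le_sum fun e' _ => norm_setIntegral_child_sub_le hψ hs k n e e')
  refine (mul_le_mul_of_nonneg_left h (by positivity)).trans (le_of_eq ?_)
  rw [Finset.sum_const, Finset.card_univ, dyadicSide_succ, nsmul_eq_mul]
  simp
  field_simp

lemma sq_integral_le {α : Type*} [MeasurableSpace α] {ν : Measure α} [IsFiniteMeasure ν]
    {g : α → ℝ} (hg : Integrable g ν) (hg2 : Integrable (fun x => g x ^ 2) ν) :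
    (∫ x, g x ∂ν) ^ 2 ≤ ν.real Set.univ * ∫ x, g x ^ 2 ∂ν := by
  rcases (measureReal_nonneg : 0 ≤ ν.real Set.univ).eq_or_lt with h | h
  · have : ν = 0 := by
      rw [← Measure.measure_univ_eq_zero]
      exact (measureReal_eq_zero_iff).1 h.symm
    simp [this]
  · set m := ν.real Set.univ
    set G := ∫ x, g x ∂ν
    have h0 : 0 ≤ ∫ x, (m * g x - G) ^ 2 ∂ν := integral_nonneg fun x => sq_nonneg _
    have h1 : ∫ x, (m * g x - G) ^ 2 ∂ν = m * (m * ∫ x, g x ^ 2 ∂ν) - m * G ^ 2 := by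
      have : ∀ x, (m * g x - G) ^ 2 = m ^ 2 * g x ^ 2 - (2 * m * G) * g x + G ^ 2 := by
        intro x; ring
      simp only [this]
      have i1 : Integrable (fun x => m ^ 2 * g x ^ 2) ν := hg2.const_mul _
      have i2 : Integrable (fun x => 2 * m * G * g x) ν := hg.const_mul _
      have i3 : Integrable (fun x => m ^ 2 * g x ^ 2 - 2 * m * G * g x) ν := i1.sub i2
      rw [integral_add i3 (integrable_const _), integral_sub i1 i2, integral_const_mul,
        integral_const_mul,
        integral_const, smul_eq_mul]
      ring
    rw [h1] at h0
    nlinarith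

lemma exists_dyadicAvg_close {ψ : E3 → ℂ} (hc : Continuous ψ) (hs : HasCompactSupport ψ) {ε : ℝ}
    (hε : 0 < ε) : ∃ d, ∀ n, ∀ x ∈ dyadicBox d n, ‖ψ x - dyadicAvg ψ d n‖ ≤ ε := by
  have hψint : Integrable ψ volume := hc.integrable_of_hasCompactSupport hs
  obtain ⟨δ, hδ, h⟩ := Metric.uniformContinuous_iff.1 (hs.uniformContinuous_of_continuous hc) ε hε
  obtain ⟨d, hd⟩ := exists_nat_gt (4 * π / δ)
  refine ⟨d, fun n x hx => ?_⟩
  have hl := dyadicSide_pos d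
  have hld : 2 * dyadicSide d < δ := by
    have h2 : (d : ℝ) < 2 ^ d := by exact_mod_cast Nat.lt_two_pow_self
    rw [div_lt_iff₀ hδ] at hd
    rw [dyadicSide, ← mul_div_assoc, div_lt_iff₀ (by positivity)]
    nlinarith
  have e1 : ψ x - dyadicAvg ψ d n = (dyadicSide d ^ 3)⁻¹ • ∫ y in dyadicBox d n, (ψ x - ψ y) := by
    rw [integral_sub (integrable_const _) hψint.integrableOn, smul_sub, dyadicAvg, setIntegral_const,
      measureReal_dyadicBox, smul_smul, inv_mul_cancel₀ (by positivity), one_smul]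
  have h2 : ‖∫ y in dyadicBox d n, (ψ x - ψ y)‖ ≤ ε * volume.real (dyadicBox d n) := by
    refine norm_setIntegral_le_of_norm_le_const ?_ fun y hy => ?_
    · rw [volume_dyadicBox]; exact ENNReal.ofReal_lt_top
    · rw [← dist_eq_norm]
      exact (h ((dist_le_of_mem_dyadicBox hx hy).trans_lt hld)).le
  rw [measureReal_dyadicBox] at h2
  rw [e1, norm_smul, norm_inv, norm_pow, Real.norm_of_nonneg hl.le]
  rw [inv_mul_le_iff₀ (by positivity)]
  linarith

lemma integrable_norm_sq_of_hasCompactSupport {V : Type*} [NormedAddCommGroup V] {f : E3 → V}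
    (hc : Continuous f) (hs : HasCompactSupport f) :
    Integrable (fun x => ‖f x‖ ^ 2) volume := by
  have h : HasCompactSupport fun x => ‖f x‖ * ‖f x‖ := hs.norm.mul_left
  simp only [← sq] at h
  exact (hc.norm.pow 2).integrable_of_hasCompactSupport h

/-- The Coulomb energy of `μ ⊗ μ` on a set of pairs. -/
def pairEnergy (μ : Measure E3) (S : Set (E3 × E3)) : ℝ≥0∞ :=
  ∫⁻ p in S, (edist p.1 p.2)⁻¹ ∂(μ.prod μ)

lemma ofReal_mul_le_pairEnergy {μ : Measure E3} {k : ℕ} {n : Fin 3 → ℤ} {S : Set (E3 × E3)}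
    (hS : S ⊆ dyadicBox k n ×ˢ dyadicBox k n) (hSm : MeasurableSet S) :
    ENNReal.ofReal (1 / (2 * dyadicSide k)) * (μ.prod μ) S ≤ pairEnergy μ S := by
  have hl := dyadicSide_pos k
  rw [pairEnergy, ← setLIntegral_const]
  refine setLIntegral_mono' hSm fun p hp => ?_
  rw [one_div, ENNReal.ofReal_inv_of_pos (by positivity), edist_dist]
  exact ENNReal.inv_le_inv.2 (ENNReal.ofReal_le_ofReal
    (dist_le_of_mem_dyadicBox (hS hp).1 (hS hp).2))

lemma measureReal_le_toReal_pairEnergy {μ : Measure E3} [IsFiniteMeasure μ] {k : ℕ}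
    {n : Fin 3 → ℤ} {S : Set (E3 × E3)} (hS : S ⊆ dyadicBox k n ×ˢ dyadicBox k n)
    (hSm : MeasurableSet S) (hfin : pairEnergy μ (dyadicBox k n ×ˢ dyadicBox k n) ≠ ⊤) :
    (μ.prod μ).real S / (2 * dyadicSide k) ≤ (pairEnergy μ S).toReal := by
  have hl := dyadicSide_pos k
  have hfin' : pairEnergy μ S ≠ ⊤ := ne_top_of_le_ne_top hfin (lintegral_mono_set hS)
  have h := ENNReal.toReal_mono hfin' (ofReal_mul_le_pairEnergy hS hSm)
  rw [ENNReal.toReal_mul, ENNReal.toReal_ofReal (by positivity)] at h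
  rw [div_eq_mul_one_div, mul_comm]
  exact h

lemma measureReal_prod_box (μ : Measure E3) [IsFiniteMeasure μ] (k : ℕ) (n : Fin 3 → ℤ) :
    (μ.prod μ).real (dyadicBox k n ×ˢ dyadicBox k n) = μ.real (dyadicBox k n) ^ 2 := by
  rw [measureReal_prod_prod, sq]

lemma sum_pairEnergy_add_le {μ : Measure E3} [IsFiniteMeasure μ]
    (hfin : ∀ k n, pairEnergy μ (dyadicBox k n ×ˢ dyadicBox k n) ≠ ⊤) (k : ℕ) (n : Fin 3 → ℤ) :
    ∑ e, (pairEnergy μ (dyadicBox (k + 1) (dyadicChild n e) ×ˢ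
          dyadicBox (k + 1) (dyadicChild n e))).toReal +
        (μ.real (dyadicBox k n) ^ 2 -
          ∑ e, μ.real (dyadicBox (k + 1) (dyadicChild n e)) ^ 2) / (2 * dyadicSide k) ≤
      (pairEnergy μ (dyadicBox k n ×ˢ dyadicBox k n)).toReal := by
  set D : (Fin 3 → Fin 2) → Set (E3 × E3) := fun e =>
    dyadicBox (k + 1) (dyadicChild n e) ×ˢ dyadicBox (k + 1) (dyadicChild n e) with hD
  set Q := dyadicBox k n ×ˢ dyadicBox k n with hQ
  have hDm : ∀ e, MeasurableSet (D e) := fun e =>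
    (measurableSet_dyadicBox _ _).prod (measurableSet_dyadicBox _ _)
  have hQm : MeasurableSet Q := (measurableSet_dyadicBox _ _).prod (measurableSet_dyadicBox _ _)
  have hUm : MeasurableSet (⋃ e, D e) := MeasurableSet.iUnion hDm
  have hdisj : Pairwise (Function.onFun Disjoint D) := fun e e' h =>
    Set.disjoint_prod.2 (Or.inl (pairwise_disjoint_dyadicChild k n h))
  have hUQ : (⋃ e, D e) ⊆ Q := Set.iUnion_subset fun e =>
    Set.prod_mono (dyadicBox_child_subset k n e) (dyadicBox_child_subset k n e)
  have hfinS : ∀ S ⊆ Q, pairEnergy μ S ≠ ⊤ := fun S hS =>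
    ne_top_of_le_ne_top (hfin k n) (lintegral_mono_set hS)
  have e1 : pairEnergy μ Q = pairEnergy μ (⋃ e, D e) + pairEnergy μ (Q \ ⋃ e, D e) := by
    rw [pairEnergy, pairEnergy, pairEnergy,
      ← lintegral_union (hQm.diff hUm) Set.disjoint_sdiff_right,
      Set.union_sdiff_cancel hUQ]
  have e2 : pairEnergy μ (⋃ e, D e) = ∑ e, pairEnergy μ (D e) := by
    rw [pairEnergy, lintegral_iUnion hDm hdisj, tsum_fintype]
    rfl
  have e3 : (μ.prod μ).real (Q \ ⋃ e, D e) = μ.real (dyadicBox k n) ^ 2 -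
      ∑ e, μ.real (dyadicBox (k + 1) (dyadicChild n e)) ^ 2 := by
    rw [measureReal_sdiff hUQ hUm, measureReal_prod_box, measureReal_iUnion_fintype hdisj hDm]
    simp only [hD, measureReal_prod_box]
  have h := measureReal_le_toReal_pairEnergy (Set.sdiff_subset (s := Q) (t := ⋃ e, D e))
    (hQm.diff hUm) (hfin k n)
  rw [e1, e2, ENNReal.toReal_add _ (hfinS _ Set.sdiff_subset), ENNReal.toReal_sum, ← e3]
  · linarith
  · exact fun e _ => hfinS _ ((Set.subset_iUnion D e).trans hUQ)
  · rw [← e2]; exact hfinS _ hUQ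

/-- Trace inequality on the cell for a measure satisfying the dyadic energy condition. -/
lemma integral_sq_sub_avg_le {μ : Measure E3} [IsFiniteMeasure μ] {A : ℝ} (hA : 0 < A)
    (hfin : ∀ k n, pairEnergy μ (dyadicBox k n ×ˢ dyadicBox k n) ≠ ⊤)
    (hμ : ∀ k n, 4 * (pairEnergy μ (dyadicBox k n ×ˢ dyadicBox k n)).toReal ≤
      A * μ.real (dyadicBox k n))
    {ψ : E3 → ℂ} (hψ : ContDiff ℝ 1 ψ) (hs : HasCompactSupport ψ) :
    ∫ x in dyadicBox 0 0, ‖ψ x - dyadicAvg ψ 0 0‖ ^ 2 ∂μ ≤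
      3072 * A * ∫ x in dyadicBox 0 0, ‖fderiv ℝ ψ x‖ ^ 2 := by
  have hDc : Continuous (fderiv ℝ ψ) := hψ.continuous_fderiv one_ne_zero
  have hDs := hs.fderiv (𝕜 := ℝ)
  have hDint : Integrable (fun x => ‖fderiv ℝ ψ x‖) volume :=
    (hDc.integrable_of_hasCompactSupport hDs).norm
  have hDint2 : Integrable (fun x => ‖fderiv ℝ ψ x‖ ^ 2) volume :=
    integrable_norm_sq_of_hasCompactSupport hDc (hs.fderiv (𝕜 := ℝ))
  obtain ⟨M, hM⟩ := hs.exists_bound_of_continuous hψ.continuous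
  have hosc : ∀ c c' : ℂ, Integrable (fun x => ‖ψ x - c‖ * ‖ψ x - c'‖) μ := by
    intro c c'
    refine Integrable.of_bound (C := (M + ‖c‖) * (M + ‖c'‖)) ?_ (ae_of_all _ fun x => ?_)
    · have := hψ.continuous
      exact Continuous.aestronglyMeasurable (by fun_prop)
    · rw [norm_mul, norm_norm, norm_norm]
      have h1 : ‖ψ x - c‖ ≤ M + ‖c‖ := (norm_sub_le _ _).trans (by linarith [hM x])
      have h2 : ‖ψ x - c'‖ ≤ M + ‖c'‖ := (norm_sub_le _ _).trans (by linarith [hM x])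
      exact mul_le_mul h1 h2 (norm_nonneg _) ((norm_nonneg _).trans h1)
  set a := dyadicAvg ψ 0 0 with ha
  have hg : Integrable (fun x => ‖ψ x - a‖) μ := by
    refine Integrable.of_bound (C := M + ‖a‖) ?_ (ae_of_all _ fun x => ?_)
    · have := hψ.continuous
      exact Continuous.aestronglyMeasurable (by fun_prop)
    · rw [norm_norm]
      exact (norm_sub_le _ _).trans (by linarith [hM x])
  have hg2 : Integrable (fun x => ‖ψ x - a‖ ^ 2) μ := by
    simpa only [sq] using hosc a a
  refine dyadic_trace (m := fun k n => μ.real (dyadicBox k n))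
    (J := fun k n => (pairEnergy μ (dyadicBox k n ×ˢ dyadicBox k n)).toReal)
    (f := fun k n => ∫ x in dyadicBox k n, ‖fderiv ℝ ψ x‖)
    (F := fun k n => ∫ x in dyadicBox k n, ‖fderiv ℝ ψ x‖ ^ 2)
    (G := fun k n => ∫ x in dyadicBox k n, ‖ψ x - a‖ ∂μ)
    (H := fun k n => ∫ x in dyadicBox k n, ‖ψ x - a‖ ^ 2 ∂μ)
    (P := fun k n => ∫ x in dyadicBox k n, ‖ψ x - dyadicAvg ψ k n‖ * ‖ψ x - a‖ ∂μ)
    hA ?_ (dyadicAdditive_setIntegral fun k n => hg.integrableOn)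
    (dyadicAdditive_setIntegral fun k n => hg2.integrableOn)
    (dyadicAdditive_setIntegral fun k n => hDint.integrableOn)
    (dyadicAdditive_setIntegral fun k n => hDint2.integrableOn)
    (fun k n => measureReal_nonneg)
    (fun k n => integral_nonneg fun x => norm_nonneg _)
    (fun k n => integral_nonneg fun x => norm_nonneg _)
    (fun k n => integral_nonneg fun x => sq_nonneg _) ?_ ?_ ?_
    (sum_pairEnergy_add_le hfin) hμ ?_ ?_ 0 ?_
  · intro k n
    simp only
    rw [dyadicBox_eq_iUnion k n, measureReal_iUnion_fintype (pairwise_disjoint_dyadicChild k n)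
      fun e => measurableSet_dyadicBox _ _]
  · intro k n
    have h := sq_integral_le (ν := μ.restrict (dyadicBox k n)) hg.integrableOn hg2.integrableOn
    rwa [measureReal_restrict_apply_univ] at h
  · intro k n
    have h := sq_integral_le (ν := volume.restrict (dyadicBox k n)) hDint.integrableOn
      hDint2.integrableOn
    rwa [measureReal_restrict_apply_univ, measureReal_dyadicBox] at h
  · intro k n
    rw [← measureReal_prod_box]
    exact measureReal_le_toReal_pairEnergy subset_rfl
      ((measurableSet_dyadicBox _ _).prod (measurableSet_dyadicBox _ _)) (hfin k n)
  · intro k n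
    set f := ∫ x in dyadicBox k n, ‖fderiv ℝ ψ x‖
    have h1 := dyadicAdditive_setIntegral (g := fun x => ‖ψ x - dyadicAvg ψ k n‖ * ‖ψ x - a‖)
      (μ := μ) (fun k n => (hosc _ _).integrableOn) k n
    have h2 := dyadicAdditive_setIntegral (g := fun x => ‖ψ x - a‖)
      (μ := μ) (fun k n => hg.integrableOn) k n
    simp only at h1 h2
    have e1 : 8 * (f * (∫ x in dyadicBox k n, ‖ψ x - a‖ ∂μ) / dyadicSide k ^ 2) =
        8 * (f / dyadicSide k ^ 2) * ∫ x in dyadicBox k n, ‖ψ x - a‖ ∂μ := by ring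
    rw [h1, e1, h2, Finset.mul_sum, ← Finset.sum_add_distrib]
    refine Finset.sum_le_sum fun e _ => ?_
    rw [← integral_const_mul, ← integral_add (hosc _ _).integrableOn
      (hg.const_mul _).integrableOn]
    refine integral_mono (hosc _ _).integrableOn
      ((hosc _ _).integrableOn.add (hg.const_mul _).integrableOn) fun x => ?_
    simp only
    rw [← add_mul]
    refine mul_le_mul_of_nonneg_right ?_ (norm_nonneg _)
    calc ‖ψ x - dyadicAvg ψ k n‖ = ‖(ψ x - dyadicAvg ψ (k + 1) (dyadicChild n e)) +
          (dyadicAvg ψ (k + 1) (dyadicChild n e) - dyadicAvg ψ k n)‖ := by congr 1; ring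
      _ ≤ _ := (norm_add_le _ _).trans
        (add_le_add_right (norm_dyadicAvg_child_sub_le hψ hs k n e) _)
  · intro ε hε
    obtain ⟨d, hd⟩ := exists_dyadicAvg_close hψ.continuous hs hε
    refine ⟨d, fun n => ?_⟩
    rw [← integral_const_mul]
    refine setIntegral_mono_on (hosc _ _).integrableOn (hg.const_mul _).integrableOn
      (measurableSet_dyadicBox _ _) fun x hx => ?_
    exact mul_le_mul_of_nonneg_right (hd n x hx) (norm_nonneg _)
  · simp only [sq, ha]

lemma pairEnergy_le_ksNorm_mul {w : E3 → ℝ≥0∞} (hw : Measurable w)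
    [IsFiniteMeasure (volume.withDensity w)] (hK : ksNorm w ≠ ⊤) (k : ℕ) (n : Fin 3 → ℤ) :
    pairEnergy (volume.withDensity w) (dyadicBox k n ×ˢ dyadicBox k n) ≤
      ksNorm w * volume.withDensity w (dyadicBox k n) := by
  set μ := volume.withDensity w with hμ
  set c := cube3 (dyadicCenter k n) (dyadicSide k) with hc
  have hae : (volume : Measure E3).restrict (dyadicBox k n) = volume.restrict c :=
    Measure.restrict_congr_set (dyadicBox_ae_eq_cube3 k n)
  have hm := measurableSet_dyadicBox k n
  have h1 : pairEnergy μ (dyadicBox k n ×ˢ dyadicBox k n) =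
      ∫⁻ x in c, ∫⁻ y in c, w x * w y / edist x y := by
    have hmeas : Measurable fun p : E3 × E3 => (edist p.1 p.2)⁻¹ := by fun_prop
    rw [pairEnergy, ← Measure.prod_restrict, lintegral_prod _ hmeas.aemeasurable, ← hae, hμ,
      restrict_withDensity hm, lintegral_withDensity_eq_lintegral_mul _ hw
        (Measurable.lintegral_prod_right' hmeas)]
    refine lintegral_congr fun x => ?_
    have hx : Measurable fun y : E3 => (edist x y)⁻¹ := by fun_prop
    rw [Pi.mul_apply, lintegral_withDensity_eq_lintegral_mul _ hw hx,
      ← lintegral_const_mul _ (hw.mul hx)]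
    refine lintegral_congr fun y => ?_
    rw [Pi.mul_apply, div_eq_mul_inv, mul_assoc]
  have h2 : μ (dyadicBox k n) = ∫⁻ x in c, w x := by
    rw [hμ, withDensity_apply _ hm, hae]
  have h3 : ksRatio w (dyadicCenter k n) (dyadicSide k) ≤ ksNorm w :=
    le_iSup_of_le _ (le_iSup_of_le _ (le_iSup_of_le (dyadicSide_pos k) le_rfl))
  rw [ksRatio, ← hc, ← h1, ← h2] at h3
  have htop : μ (dyadicBox k n) ≠ ⊤ := measure_ne_top _ _
  by_cases h0 : μ (dyadicBox k n) = 0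
  · rw [h0, ENNReal.inv_zero] at h3
    have : pairEnergy μ (dyadicBox k n ×ˢ dyadicBox k n) = 0 := by
      by_contra hne
      rw [ENNReal.top_mul hne] at h3
      exact hK (top_le_iff.1 h3)
    rw [this]
    exact zero_le
  · rw [ENNReal.inv_mul_le_iff h0 htop] at h3
    rwa [mul_comm]

lemma norm_dyadicAvg_sq_le {ψ : E3 → ℂ} (hc : Continuous ψ) (hs : HasCompactSupport ψ) :
    ‖dyadicAvg ψ 0 0‖ ^ 2 ≤ ∫ x in dyadicBox 0 0, ‖ψ x‖ ^ 2 := by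
  have hl := dyadicSide_pos 0
  have hψint : Integrable (fun x => ‖ψ x‖) volume := (hc.integrable_of_hasCompactSupport hs).norm
  have hψint2 : Integrable (fun x => ‖ψ x‖ ^ 2) volume :=
    integrable_norm_sq_of_hasCompactSupport hc hs
  have h := sq_integral_le (ν := volume.restrict (dyadicBox 0 0)) hψint.integrableOn
    hψint2.integrableOn
  rw [measureReal_restrict_apply_univ, measureReal_dyadicBox] at h
  have hl1 : 1 ≤ dyadicSide 0 := by
    simp only [dyadicSide, pow_zero, div_one]
    linarith [Real.pi_gt_three]
  have hl3 : 1 ≤ dyadicSide 0 ^ 3 := one_le_pow₀ hl1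
  have hI : 0 ≤ ∫ x in dyadicBox 0 0, ‖ψ x‖ ^ 2 := integral_nonneg fun x => sq_nonneg _
  rw [dyadicAvg, norm_smul, mul_pow, norm_inv, norm_pow, Real.norm_of_nonneg hl.le]
  have h2 : ‖∫ x in dyadicBox 0 0, ψ x‖ ^ 2 ≤
      dyadicSide 0 ^ 3 * ∫ x in dyadicBox 0 0, ‖ψ x‖ ^ 2 :=
    (pow_le_pow_left₀ (norm_nonneg _) (norm_integral_le_integral_norm _) 2).trans h
  rw [inv_pow, inv_mul_le_iff₀ (by positivity)]
  nlinarith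

/-- Local form bound on the cell `Ω`:
`∫_Ω |ψ|²|W| ≤ C‖Wχ_Ω‖_F ∫_Ω |∇ψ|² + C (∫_Ω |W|)(∫_Ω |ψ|²)`. -/
theorem stmt3 :
    ∃ C : ℝ≥0, 0 < C ∧ ∀ W : E3 → ℝ, Measurable W → IntegrableOn W Ω3 →
      ksNorm (fun x => (‖Set.indicator Ω3 W x‖₊ : ℝ≥0∞)) < ⊤ →
      ∀ ψ : E3 → ℂ, ContDiff ℝ 1 ψ → HasCompactSupport ψ →
        (∫⁻ x in Ω3, (‖ψ x‖₊ : ℝ≥0∞) ^ 2 * (‖W x‖₊ : ℝ≥0∞)) ≤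
          C * ksNorm (fun x => (‖Set.indicator Ω3 W x‖₊ : ℝ≥0∞)) *
              (∫⁻ x in Ω3, (‖fderiv ℝ ψ x‖₊ : ℝ≥0∞) ^ 2)
          + C * (∫⁻ x in Ω3, (‖W x‖₊ : ℝ≥0∞)) * (∫⁻ x in Ω3, (‖ψ x‖₊ : ℝ≥0∞) ^ 2) := by
  refine ⟨24576, by norm_num, fun W hW hWint hK ψ hψ hs => ?_⟩
  set w : E3 → ℝ≥0∞ := fun x => (‖Set.indicator Ω3 W x‖₊ : ℝ≥0∞) with hw
  have hΩ : MeasurableSet Ω3 := Ω3_eq_dyadicBox ▸ measurableSet_dyadicBox 0 0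
  have hwm : Measurable w := (hW.indicator hΩ).enorm
  have hwfin : ∫⁻ x, w x ≠ ⊤ := ((integrable_indicator_iff hΩ).2 hWint).2.ne
  have : IsFiniteMeasure (volume.withDensity w) := isFiniteMeasure_withDensity hwfin
  set μ := volume.withDensity w with hμ
  have hwW : ∀ x ∈ Ω3, w x = (‖W x‖₊ : ℝ≥0∞) := fun x hx => by
    simp only [hw, Set.indicator_of_mem hx]
  have hE := pairEnergy_le_ksNorm_mul hwm hK.ne
  have hfin : ∀ k n, pairEnergy μ (dyadicBox k n ×ˢ dyadicBox k n) ≠ ⊤ := fun k n =>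
    ne_top_of_le_ne_top (ENNReal.mul_ne_top hK.ne (measure_ne_top _ _)) (hE k n)
  set K := (ksNorm w).toReal with hKdef
  have hJ : ∀ k n, (pairEnergy μ (dyadicBox k n ×ˢ dyadicBox k n)).toReal ≤
      K * μ.real (dyadicBox k n) := fun k n => by
    have := ENNReal.toReal_mono (ENNReal.mul_ne_top hK.ne (measure_ne_top _ _)) (hE k n)
    rwa [ENNReal.toReal_mul] at this
  have hDc : Continuous (fderiv ℝ ψ) := hψ.continuous_fderiv one_ne_zero
  have hK0 : 0 ≤ K := ENNReal.toReal_nonneg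
  set F := ∫ x in Ω3, ‖fderiv ℝ ψ x‖ ^ 2 with hF
  have hF0 : 0 ≤ F := integral_nonneg fun x => sq_nonneg _
  set a := dyadicAvg ψ 0 0 with ha
  have hH : ∫ x in Ω3, ‖ψ x - a‖ ^ 2 ∂μ ≤ 12288 * K * F := by
    refine le_of_forall_pos_le_add fun η hη => ?_
    have h := integral_sq_sub_avg_le (A := 4 * K + η / (3072 * (F + 1))) (by positivity) hfin
      (fun k n => by
        have h1 := hJ k n
        have h2 : 0 ≤ η / (3072 * (F + 1)) * μ.real (dyadicBox k n) := by positivity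
        linarith) hψ hs
    rw [← Ω3_eq_dyadicBox, ← hF] at h
    have h2 : 3072 * (η / (3072 * (F + 1))) * F ≤ η := by
      have : 3072 * (η / (3072 * (F + 1))) * F = η * (F / (F + 1)) := by field_simp
      rw [this]
      exact mul_le_of_le_one_right hη.le ((div_le_one (by positivity)).2 (by linarith))
    linarith
  have hDint2 : Integrable (fun x => ‖fderiv ℝ ψ x‖ ^ 2) volume :=
    integrable_norm_sq_of_hasCompactSupport hDc (hs.fderiv (𝕜 := ℝ))
  have hψint2 : Integrable (fun x => ‖ψ x‖ ^ 2) volume :=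
    integrable_norm_sq_of_hasCompactSupport hψ.continuous hs
  obtain ⟨M, hM⟩ := hs.exists_bound_of_continuous hψ.continuous
  have hψc := hψ.continuous
  have hoscint : Integrable (fun x => ‖ψ x - a‖ ^ 2) μ := by
    refine Integrable.of_bound (C := (M + ‖a‖) ^ 2)
      (Continuous.aestronglyMeasurable (by fun_prop)) (ae_of_all _ fun x => ?_)
    rw [norm_pow, norm_norm]
    exact pow_le_pow_left₀ (norm_nonneg _) ((norm_sub_le _ _).trans (by linarith [hM x])) 2
  have hsq : ∀ {V : Type} [NormedAddCommGroup V] (y : V),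
      (‖y‖₊ : ℝ≥0∞) ^ 2 = ENNReal.ofReal (‖y‖ ^ 2) := fun y => by
    rw [ENNReal.ofReal_pow (norm_nonneg _), ofReal_norm]; rfl
  have eF : ∫⁻ x in Ω3, (‖fderiv ℝ ψ x‖₊ : ℝ≥0∞) ^ 2 = ENNReal.ofReal F := by
    rw [hF, ofReal_integral_eq_lintegral_ofReal hDint2.integrableOn
      (ae_of_all _ fun x => sq_nonneg _)]
    exact lintegral_congr fun x => hsq _
  have eψ : ∫⁻ x in Ω3, (‖ψ x‖₊ : ℝ≥0∞) ^ 2 = ENNReal.ofReal (∫ x in Ω3, ‖ψ x‖ ^ 2) := by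
    rw [ofReal_integral_eq_lintegral_ofReal hψint2.integrableOn
      (ae_of_all _ fun x => sq_nonneg _)]
    exact lintegral_congr fun x => hsq _
  have eW : ∫⁻ x in Ω3, (‖W x‖₊ : ℝ≥0∞) = μ Ω3 := by
    rw [hμ, withDensity_apply _ hΩ]
    exact setLIntegral_congr_fun hΩ fun x hx => (hwW x hx).symm
  have eL : ∫⁻ x in Ω3, (‖ψ x‖₊ : ℝ≥0∞) ^ 2 * (‖W x‖₊ : ℝ≥0∞) =
      ∫⁻ x in Ω3, (‖ψ x‖₊ : ℝ≥0∞) ^ 2 ∂μ := by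
    have hm : Measurable fun x => (‖ψ x‖₊ : ℝ≥0∞) ^ 2 := by fun_prop
    rw [hμ, restrict_withDensity hΩ, lintegral_withDensity_eq_lintegral_mul _ hwm hm]
    refine setLIntegral_congr_fun hΩ fun x hx => ?_
    simp only [Pi.mul_apply, hwW x hx, mul_comm]
  have hpt : ∀ x, (‖ψ x‖₊ : ℝ≥0∞) ^ 2 ≤
      ENNReal.ofReal (2 * ‖ψ x - a‖ ^ 2) + ENNReal.ofReal (2 * ‖a‖ ^ 2) := fun x => by
    rw [hsq, ← ENNReal.ofReal_add (by positivity) (by positivity)]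
    refine ENNReal.ofReal_le_ofReal ?_
    have h1 : ‖ψ x‖ ≤ ‖ψ x - a‖ + ‖a‖ := by simpa using norm_add_le (ψ x - a) a
    have h2 := pow_le_pow_left₀ (norm_nonneg _) h1 2
    nlinarith [sq_nonneg (‖ψ x - a‖ - ‖a‖)]
  have hosc : ∫⁻ x in Ω3, ENNReal.ofReal (2 * ‖ψ x - a‖ ^ 2) ∂μ ≤
      24576 * ksNorm w * ENNReal.ofReal F := by
    rw [← ofReal_integral_eq_lintegral_ofReal (hoscint.const_mul 2).integrableOn
      (ae_of_all _ fun x => by positivity), integral_const_mul, ← ENNReal.ofReal_toReal hK.ne,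
      ← hKdef, show (24576 : ℝ≥0∞) = ENNReal.ofReal 24576 by simp,
      ← ENNReal.ofReal_mul (by norm_num), ← ENNReal.ofReal_mul (by positivity)]
    exact ENNReal.ofReal_le_ofReal (by linarith)
  have havg : ENNReal.ofReal (2 * ‖a‖ ^ 2) ≤
      24576 * ENNReal.ofReal (∫ x in Ω3, ‖ψ x‖ ^ 2) := by
    rw [show (24576 : ℝ≥0∞) = ENNReal.ofReal 24576 by simp, ← ENNReal.ofReal_mul (by norm_num)]
    refine ENNReal.ofReal_le_ofReal ?_
    have h := norm_dyadicAvg_sq_le hψc hs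
    rw [← Ω3_eq_dyadicBox, ← ha] at h
    nlinarith [sq_nonneg ‖a‖]
  rw [eL, eF, eW, eψ]
  calc ∫⁻ x in Ω3, (‖ψ x‖₊ : ℝ≥0∞) ^ 2 ∂μ
      ≤ ∫⁻ x in Ω3, (ENNReal.ofReal (2 * ‖ψ x - a‖ ^ 2) + ENNReal.ofReal (2 * ‖a‖ ^ 2)) ∂μ :=
        lintegral_mono hpt
    _ = ∫⁻ x in Ω3, ENNReal.ofReal (2 * ‖ψ x - a‖ ^ 2) ∂μ +
          ENNReal.ofReal (2 * ‖a‖ ^ 2) * μ Ω3 := by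
        rw [lintegral_add_right _ measurable_const, setLIntegral_const]
    _ ≤ 24576 * ksNorm w * ENNReal.ofReal F +
          24576 * ENNReal.ofReal (∫ x in Ω3, ‖ψ x‖ ^ 2) * μ Ω3 := by gcongr
    _ = _ := by
        push_cast
        ring
end
end

section
/- There is an absolute constant C > 0 such that for every measurable function W on ℝ³ that is periodic with respect to the lattice (2πℤ)³, integrable on Ω = [0,2π)³, and satisfies ‖W χ_Ω‖_F < ∞, and every continuously differentiable compactly supported function ψ : ℝ³ → ℂ, one has ∫_{ℝ³} |ψ(x)|² |W(x)| dx ≤ C ‖W χ_Ω‖_F ∫_{ℝ³} |∇ψ(x)|² dx + C (∫_Ω |W(x)| dx)(∫_{ℝ³} |ψ(x)|² dx). -/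
open MeasureTheory ENNReal NNReal Real Filter
open scoped Classical

noncomputable section

/-- A half-open axis-parallel cube, given by its lower corner and its side length. -/
structure Cell where
  corner : E3
  side : ℝ
  side_pos : 0 < side

namespace Cell

/-- The set of points of a half-open cube. -/
def toSet (Q : Cell) : Set E3 := {x | ∀ i, Q.corner i ≤ x i ∧ x i < Q.corner i + Q.side}

/-- The side length as an extended nonnegative real. -/
def len (Q : Cell) : ℝ≥0∞ := ENNReal.ofReal Q.side

/-- The dyadic children of a cube. -/
def child (Q : Cell) (e : Fin 3 → Bool) : Cell where
  corner := WithLp.toLp 2 fun i => Q.corner i + if e i then Q.side / 2 else 0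
  side := Q.side / 2
  side_pos := half_pos Q.side_pos

/-- The sum of `v` over the dyadic descendants of `Q` of the generations `0, …, n - 1`. -/
def treeSum {M : Type*} [AddCommMonoid M] (v : Cell → M) : ℕ → Cell → M
  | 0, _ => 0
  | n + 1, Q => v Q + ∑ e, treeSum v n (Q.child e)

theorem len_ne_zero (Q : Cell) : Q.len ≠ 0 := by
  simpa [len] using Q.side_pos

theorem len_ne_top (Q : Cell) : Q.len ≠ ⊤ := ENNReal.ofReal_ne_top

theorem two_mul_len_child (Q : Cell) (e : Fin 3 → Bool) : 2 * (Q.child e).len = Q.len := by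
  have : (2 : ℝ≥0∞) = ENNReal.ofReal 2 := by simp
  rw [len, len, this, ← ENNReal.ofReal_mul (by norm_num)]
  simp only [child]
  congr 1
  ring

theorem inv_len_child (Q : Cell) (e : Fin 3 → Bool) : (Q.child e).len⁻¹ = 2 * Q.len⁻¹ := by
  rw [← two_mul_len_child Q e, ENNReal.mul_inv (by simp) (by simp), ← mul_assoc,
    ENNReal.mul_inv_cancel (by simp) (by simp), one_mul]

theorem measurableSet_toSet (Q : Cell) : MeasurableSet Q.toSet := by
  have : Q.toSet = ⋂ i, {x : E3 | Q.corner i ≤ x i ∧ x i < Q.corner i + Q.side} := by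
    ext x; simp [toSet]
  rw [this]
  refine MeasurableSet.iInter fun i => ?_
  have hm : Measurable fun x : E3 => x i := by fun_prop
  exact (measurableSet_le measurable_const hm).inter (measurableSet_lt hm measurable_const)

theorem convex_toSet (Q : Cell) : Convex ℝ Q.toSet := by
  intro x hx y hy a b ha hb hab i
  have h1 := hx i
  have h2 := hy i
  have hb' : b = 1 - a := by linarith
  simp only [PiLp.add_apply, PiLp.smul_apply, smul_eq_mul]
  rcases ha.eq_or_lt with h | h
  · subst h
    simp at hb'
    subst hb'
    simpa using h2
  · subst hb'
    constructor
    · nlinarith [mul_le_mul_of_nonneg_left h1.1 ha, mul_le_mul_of_nonneg_left h2.1 hb]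
    · nlinarith [mul_lt_mul_of_pos_left h1.2 h, mul_le_mul_of_nonneg_left h2.2.le hb]

theorem toSet_eq_preimage (Q : Cell) :
    Q.toSet = (WithLp.ofLp : E3 → Fin 3 → ℝ) ⁻¹'
      Set.pi Set.univ fun i => Set.Ico (Q.corner i) (Q.corner i + Q.side) := by
  ext x
  simp [toSet, Set.mem_pi]

theorem volume_toSet (Q : Cell) : volume Q.toSet = Q.len ^ 3 := by
  rw [toSet_eq_preimage, (PiLp.volume_preserving_ofLp (Fin 3)).measure_preimage
    (MeasurableSet.univ_pi fun i => measurableSet_Ico).nullMeasurableSet, Real.volume_pi_Ico]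
  simp [len]

theorem toSet_ae_eq_cube3 (Q : Cell) :
    Q.toSet =ᵐ[volume] cube3 (WithLp.toLp 2 fun i => Q.corner i + Q.side / 2) Q.side := by
  have h : cube3 (WithLp.toLp 2 fun i => Q.corner i + Q.side / 2) Q.side =
      (WithLp.ofLp : E3 → Fin 3 → ℝ) ⁻¹'
        Set.Icc (WithLp.ofLp Q.corner) (fun i => Q.corner i + Q.side) := by
    ext x
    simp only [cube3, Set.mem_ofPred_eq, abs_le, Set.mem_preimage, Set.mem_Icc, Pi.le_def,
      ← forall_and]
    refine forall_congr' fun i => ?_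
    constructor <;> rintro ⟨h1, h2⟩ <;> constructor <;> linarith
  rw [toSet_eq_preimage, h]
  exact (PiLp.volume_preserving_ofLp (Fin 3)).quasiMeasurePreserving.preimage_ae_eq
    Measure.univ_pi_Ico_ae_eq_Icc

theorem edist_le {Q : Cell} {x y : E3} (hx : x ∈ Q.toSet) (hy : y ∈ Q.toSet) :
    edist x y ≤ 2 * Q.len := by
  have h2 : (2 : ℝ≥0∞) * Q.len = ENNReal.ofReal (2 * Q.side) := by
    rw [ENNReal.ofReal_mul (by norm_num)]; simp [len]
  rw [h2, edist_dist]
  refine ENNReal.ofReal_le_ofReal ?_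
  rw [EuclideanSpace.dist_eq]
  refine Real.sqrt_le_iff.2 ⟨by linarith [Q.side_pos], ?_⟩
  have key : ∀ i, dist (x i) (y i) ^ 2 ≤ Q.side ^ 2 := fun i => by
    refine pow_le_pow_left₀ dist_nonneg ?_ 2
    rw [Real.dist_eq, abs_le]
    constructor <;> linarith [(hx i).1, (hx i).2, (hy i).1, (hy i).2]
  rw [Fin.sum_univ_three]
  nlinarith [key 0, key 1, key 2, sq_nonneg Q.side]

theorem iUnion_child (Q : Cell) : ⋃ e, (Q.child e).toSet = Q.toSet := by
  ext x
  simp only [Set.mem_iUnion, toSet, child, Set.mem_ofPred_eq]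
  have hs := Q.side_pos
  constructor
  · rintro ⟨e, he⟩ i
    have := he i
    split_ifs at this <;> constructor <;> linarith
  · intro hx
    refine ⟨fun i => decide (Q.corner i + Q.side / 2 ≤ x i), fun i => ?_⟩
    have := hx i
    by_cases h : Q.corner i + Q.side / 2 ≤ x i
    · simp only [decide_eq_true_eq, if_pos h]
      constructor <;> linarith
    · simp only [decide_eq_true_eq, if_neg h]
      constructor <;> linarith

theorem child_subset (Q : Cell) (e : Fin 3 → Bool) : (Q.child e).toSet ⊆ Q.toSet :=
  Q.iUnion_child ▸ Set.subset_iUnion (fun e => (Q.child e).toSet) e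

theorem disjoint_child (Q : Cell) : Pairwise fun e e' =>
    Disjoint (Q.child e).toSet (Q.child e').toSet := by
  intro e e' hne
  rw [Set.disjoint_left]
  intro x hx hx'
  apply hne
  funext i
  have h1 := hx i
  have h2 := hx' i
  simp only [child] at h1 h2
  have hs := Q.side_pos
  cases h : e i <;> cases h' : e' i <;> simp [h, h'] at h1 h2 ⊢ <;> linarith

theorem setLIntegral_eq_sum_child (Q : Cell) (f : E3 → ℝ≥0∞) :
    ∫⁻ x in Q.toSet, f x = ∑ e, ∫⁻ x in (Q.child e).toSet, f x := by
  rw [← iUnion_child, lintegral_iUnion (fun e => measurableSet_toSet _) Q.disjoint_child,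
    tsum_fintype]

theorem treeSum_nonneg {v : Cell → ℝ} (h : ∀ Q, 0 ≤ v Q) (n : ℕ) (Q : Cell) :
    0 ≤ treeSum v n Q := by
  induction n generalizing Q with
  | zero => exact le_rfl
  | succ n ih => exact add_nonneg (h Q) (Finset.sum_nonneg fun e _ => ih _)

theorem treeSum_ofReal {v : Cell → ℝ} (h : ∀ Q, 0 ≤ v Q) (n : ℕ) (Q : Cell) :
    treeSum (fun R => ENNReal.ofReal (v R)) n Q = ENNReal.ofReal (treeSum v n Q) := by
  induction n generalizing Q with
  | zero => simp [treeSum]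
  | succ n ih =>
    simp only [treeSum]
    rw [ENNReal.ofReal_add (h Q) (Finset.sum_nonneg fun e _ => treeSum_nonneg h _ _),
      ENNReal.ofReal_sum_of_nonneg fun e _ => treeSum_nonneg h _ _]
    simp only [ih]

/-- The Bellman function form of the dyadic Carleson embedding theorem. -/
theorem carleson_bellman {α w g G : Cell → ℝ} {A : ℝ} (hA : 0 < A) (hα : ∀ Q, 0 ≤ α Q)
    (hw : ∀ Q, 0 ≤ w Q) (hg : ∀ Q, 0 ≤ g Q) (hws : ∀ Q, w Q = ∑ e, w (Q.child e))
    (hgs : ∀ Q, g Q = ∑ e, g (Q.child e)) (hGs : ∀ Q, G Q = ∑ e, G (Q.child e))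
    (hG : ∀ Q t, 0 ≤ t → 2 * t * g Q ≤ G Q + t ^ 2 * w Q)
    (htest : ∀ n Q, treeSum (fun R => α R * w R ^ 2) n Q ≤ A * w Q) (n : ℕ) (Q : Cell) (t : ℝ)
    (ht : 0 ≤ t) :
    treeSum (fun R => α R * g R ^ 2) n Q + 4 * A * (2 * t * g Q) ≤
      4 * A * G Q + 4 * A * t ^ 2 * w Q
        + 4 * t ^ 2 * treeSum (fun R => α R * w R ^ 2) n Q := by
  induction n generalizing Q t with
  | zero =>
    simp only [treeSum]
    nlinarith [mul_le_mul_of_nonneg_left (hG Q t ht) hA.le]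
  | succ n ih =>
    have htest' := htest (n + 1) Q
    simp only [treeSum] at htest' ⊢
    set S := ∑ e, treeSum (fun R => α R * g R ^ 2) n (Q.child e)
    set M := ∑ e, treeSum (fun R => α R * w R ^ 2) n (Q.child e)
    have hM : 0 ≤ M := Finset.sum_nonneg fun e _ =>
      treeSum_nonneg (fun R => mul_nonneg (hα R) (sq_nonneg _)) _ _
    have hsum : ∀ s, 0 ≤ s → S + 4 * A * (2 * s * g Q) ≤
        4 * A * G Q + 4 * A * s ^ 2 * w Q + 4 * s ^ 2 * M := by
      intro s hs
      have := Finset.sum_le_sum fun e (_ : e ∈ Finset.univ) => ih (Q.child e) s hs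
      simp only [Finset.sum_add_distrib, ← Finset.mul_sum] at this
      rwa [← hgs, ← hws, ← hGs] at this
    rcases (hw Q).eq_or_lt with h0 | hpos
    · have hg0 : g Q = 0 := by
        by_contra hne
        have hgp : 0 < g Q := lt_of_le_of_ne (hg Q) (Ne.symm hne)
        have hG0 := hG Q ((|G Q| + 1) / g Q) (by positivity)
        rw [← h0, mul_zero, add_zero, mul_assoc, div_mul_cancel₀ _ hgp.ne'] at hG0
        nlinarith [le_abs_self (G Q), abs_nonneg (G Q)]
      have := hsum t ht
      rw [← h0, hg0] at this ⊢
      simpa using this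
    · set W := w Q
      set p := α Q * W ^ 2
      have hp : 0 ≤ p := mul_nonneg (hα Q) (sq_nonneg _)
      set y := W + M / A with hy
      have hyA : A * y = A * W + M := by rw [hy]; field_simp
      have hy0 : 0 < y := by positivity
      have hyp : A * y + p ≤ 2 * W * A := by linarith
      have hy2 : y ≤ 2 * W := by
        have : A * y ≤ A * (2 * W) := by linarith
        exact le_of_mul_le_mul_left this hA
      set u := g Q / y with hu
      have hgu : g Q = u * y := by rw [hu]; field_simp
      have hu0 : 0 ≤ u := div_nonneg (hg Q) hy0.le
      have h1 := hsum u hu0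
      have h2 : 4 * u ^ 2 * (A * y) = 4 * u ^ 2 * (A * W + M) := by rw [hyA]
      have h3 : 4 * t ^ 2 * (A * y) = 4 * t ^ 2 * (A * W + M) := by rw [hyA]
      have key : α Q * (u * y) ^ 2 ≤ 4 * (A * y) * (u - t) ^ 2 + 4 * p * t ^ 2 := by
        have hYp : 0 < A * y + p := by positivity
        refine le_of_mul_le_mul_left ?_ hYp
        have e1 : 4 * (A * y) * p * u ^ 2 ≤
            (A * y + p) * (4 * (A * y) * (u - t) ^ 2 + 4 * p * t ^ 2) := by
          nlinarith [sq_nonneg (A * y * (u - t) - p * t)]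
        refine le_trans ?_ e1
        have e2 : (A * y + p) * y ≤ 4 * W ^ 2 * A := by
          calc (A * y + p) * y ≤ (2 * W * A) * (2 * W) := by gcongr
            _ = _ := by ring
        have e3 : 0 ≤ α Q * u ^ 2 * y := mul_nonneg (mul_nonneg (hα Q) (sq_nonneg _)) hy0.le
        calc (A * y + p) * (α Q * (u * y) ^ 2) = (α Q * u ^ 2 * y) * ((A * y + p) * y) := by ring
          _ ≤ (α Q * u ^ 2 * y) * (4 * W ^ 2 * A) := by gcongr
          _ = _ := by ring
      rw [hgu] at h1 ⊢
      nlinarith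

/-- The dyadic Carleson embedding theorem. -/
theorem carleson_embedding {w u : E3 → ℝ≥0∞} (hwm : Measurable w) (hum : Measurable u)
    (hw : ∫⁻ x, w x ≠ ⊤) (hu : ∫⁻ x, u x ^ 2 * w x ≠ ⊤) {A : ℝ} (hA : 0 < A)
    (htest : ∀ n Q, treeSum (fun R => R.len⁻¹ * (∫⁻ x in R.toSet, w x) ^ 2) n Q ≤
      ENNReal.ofReal A * ∫⁻ x in Q.toSet, w x) (n : ℕ) (Q : Cell) :
    treeSum (fun R => R.len⁻¹ * (∫⁻ x in R.toSet, u x * w x) ^ 2) n Q ≤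
      4 * ENNReal.ofReal A * ∫⁻ x in Q.toSet, u x ^ 2 * w x := by
  have hwQ : ∀ R : Cell, ∫⁻ x in R.toSet, w x ≠ ⊤ := fun R =>
    ne_top_of_le_ne_top hw (setLIntegral_le_lintegral _ _)
  have hGQ : ∀ R : Cell, ∫⁻ x in R.toSet, u x ^ 2 * w x ≠ ⊤ := fun R =>
    ne_top_of_le_ne_top hu (setLIntegral_le_lintegral _ _)
  have young : ∀ (R : Cell) (t : ℝ), 0 ≤ t → ENNReal.ofReal (2 * t) * ∫⁻ x in R.toSet, u x * w x ≤
      (∫⁻ x in R.toSet, u x ^ 2 * w x) + ENNReal.ofReal (t ^ 2) * ∫⁻ x in R.toSet, w x := by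
    intro R t ht
    rw [← lintegral_const_mul (f := fun x => u x * w x) _ (hum.mul hwm),
      ← lintegral_const_mul _ hwm, ← lintegral_add_right _ (hwm.const_mul _)]
    refine lintegral_mono fun x => ?_
    rw [← mul_assoc, ← add_mul]
    gcongr
    rcases eq_or_ne (u x) ⊤ with h | h
    · simp [h]
    · rw [← ENNReal.ofReal_toReal h, ← ENNReal.ofReal_pow toReal_nonneg,
        ← ENNReal.ofReal_mul (by positivity), ← ENNReal.ofReal_add (by positivity) (by positivity)]
      exact ENNReal.ofReal_le_ofReal (by nlinarith [sq_nonneg ((u x).toReal - t)])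
  have hgQ : ∀ R : Cell, ∫⁻ x in R.toSet, u x * w x ≠ ⊤ := fun R h => by
    have := young R 1 zero_le_one
    rw [h, ENNReal.mul_top (by simp)] at this
    simp [hwQ R, hGQ R] at this
  have hconv : ∀ v : Cell → ℝ≥0∞, (∀ R, v R ≠ ⊤) → (fun R : Cell => R.len⁻¹ * v R ^ 2) =
      fun R => ENNReal.ofReal (R.side⁻¹ * (v R).toReal ^ 2) := by
    intro v hv
    funext R
    have hs := R.side_pos
    rw [ENNReal.ofReal_mul (by positivity), ENNReal.ofReal_pow toReal_nonneg,
      ENNReal.ofReal_toReal (hv R), ENNReal.ofReal_inv_of_pos hs, len]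
  have hsn : ∀ v : Cell → ℝ≥0∞, ∀ R : Cell, 0 ≤ R.side⁻¹ * (v R).toReal ^ 2 := fun v R =>
    mul_nonneg (inv_nonneg.2 R.side_pos.le) (sq_nonneg _)
  have main := carleson_bellman (α := fun R => R.side⁻¹)
    (w := fun R => (∫⁻ x in R.toSet, w x).toReal)
    (g := fun R => (∫⁻ x in R.toSet, u x * w x).toReal)
    (G := fun R => (∫⁻ x in R.toSet, u x ^ 2 * w x).toReal) hA
    (fun R => inv_nonneg.2 R.side_pos.le) (fun _ => toReal_nonneg) (fun _ => toReal_nonneg)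
    (fun R => by
      rw [setLIntegral_eq_sum_child, ENNReal.toReal_sum fun e _ => hwQ _])
    (fun R => by
      rw [setLIntegral_eq_sum_child, ENNReal.toReal_sum fun e _ => hgQ _])
    (fun R => by
      rw [setLIntegral_eq_sum_child, ENNReal.toReal_sum fun e _ => hGQ _])
    (fun R t ht => by
      have := ENNReal.toReal_mono (by finiteness [hGQ R, hwQ R]) (young R t ht)
      rwa [ENNReal.toReal_add (hGQ R) (by finiteness [hwQ R]), ENNReal.toReal_mul,
        ENNReal.toReal_mul, ENNReal.toReal_ofReal (by positivity),
        ENNReal.toReal_ofReal (by positivity)] at this)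
    (fun n R => by
      have := htest n R
      rw [hconv _ hwQ, treeSum_ofReal (hsn _), ← ENNReal.ofReal_toReal (hwQ R),
        ← ENNReal.ofReal_mul hA.le] at this
      exact (ENNReal.ofReal_le_ofReal_iff (by positivity)).1 this) n Q 0 le_rfl
  rw [hconv _ hgQ, treeSum_ofReal (hsn _)]
  have h4 : (4 : ℝ≥0∞) = ENNReal.ofReal 4 := by simp
  rw [← ENNReal.ofReal_toReal (hGQ Q), h4, ← ENNReal.ofReal_mul (by norm_num),
    ← ENNReal.ofReal_mul (by positivity)]
  exact ENNReal.ofReal_le_ofReal (by simpa using main)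

theorem two_mul_inv_len_le (Q : Cell) {x y : E3} (hx : x ∈ Q.toSet) (hy : y ∈ Q.toSet) :
    2 * Q.len⁻¹ ≤ 4 * (edist x y)⁻¹ := by
  have h := ENNReal.inv_le_inv.2 (edist_le hx hy)
  rw [ENNReal.mul_inv (by simp) (by simp)] at h
  calc 2 * Q.len⁻¹ = (2 * 2⁻¹) * (2 * Q.len⁻¹) := by
        rw [ENNReal.mul_inv_cancel (by simp) (by simp), one_mul]
    _ = 4 * (2⁻¹ * Q.len⁻¹) := by ring
    _ ≤ _ := by gcongr

theorem two_mul_inv_len_mul_le (Q : Cell) {w : E3 → ℝ≥0∞} (hw : Measurable w) {s t : Set E3}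
    (hsm : MeasurableSet s) (htm : MeasurableSet t) (hs : s ⊆ Q.toSet) (ht : t ⊆ Q.toSet) :
    2 * Q.len⁻¹ * ((∫⁻ x in s, w x) * ∫⁻ y in t, w y) ≤
      4 * ∫⁻ x in s, ∫⁻ y in t, w x * w y / edist x y := by
  have hi : (2 * Q.len⁻¹ : ℝ≥0∞) ≠ ⊤ :=
    ENNReal.mul_ne_top (by simp) (by simp [len_ne_zero])
  rw [← lintegral_mul_const _ hw, ← lintegral_const_mul' _ _ hi,
    ← lintegral_const_mul' _ _ (by simp)]
  refine setLIntegral_mono' hsm fun x hx => ?_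
  rw [← lintegral_const_mul _ hw, ← lintegral_const_mul' _ _ hi,
    ← lintegral_const_mul' _ _ (by simp)]
  refine setLIntegral_mono' htm fun y hy => ?_
  calc 2 * Q.len⁻¹ * (w x * w y) ≤ 4 * (edist x y)⁻¹ * (w x * w y) := by
        gcongr ?_ * _
        exact Q.two_mul_inv_len_le (hs hx) (ht hy)
    _ = _ := by rw [div_eq_mul_inv]; ring

theorem setLIntegral_setLIntegral_eq_sum_child (Q : Cell) {k : E3 → E3 → ℝ≥0∞}
    (hk : Measurable (Function.uncurry k)) :
    ∫⁻ x in Q.toSet, ∫⁻ y in Q.toSet, k x y =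
      ∑ e, ∑ e', ∫⁻ x in (Q.child e).toSet, ∫⁻ y in (Q.child e').toSet, k x y := by
  rw [setLIntegral_eq_sum_child]
  refine Finset.sum_congr rfl fun e _ => ?_
  rw [← lintegral_finsetSum _ fun e' _ => hk.lintegral_prod_right]
  exact lintegral_congr fun x => setLIntegral_eq_sum_child Q _

theorem treeSum_sq_le_energy {w : E3 → ℝ≥0∞} (hw : Measurable w) (n : ℕ) (Q : Cell) :
    treeSum (fun R => R.len⁻¹ * (∫⁻ x in R.toSet, w x) ^ 2) n Q
        + Q.len⁻¹ * (∫⁻ x in Q.toSet, w x) ^ 2 ≤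
      4 * ∫⁻ x in Q.toSet, ∫⁻ y in Q.toSet, w x * w y / edist x y := by
  induction n generalizing Q with
  | zero =>
    refine le_trans ?_ (Q.two_mul_inv_len_mul_le hw Q.measurableSet_toSet Q.measurableSet_toSet
      subset_rfl subset_rfl)
    rw [treeSum, zero_add, ← sq, mul_assoc, two_mul]
    exact le_self_add
  | succ n ih =>
    have hk : Measurable (Function.uncurry fun x y : E3 => w x * w y / edist x y) := by
      unfold Function.uncurry; fun_prop
    have hsq : Q.len⁻¹ * (∫⁻ x in Q.toSet, w x) ^ 2 + Q.len⁻¹ * (∫⁻ x in Q.toSet, w x) ^ 2 =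
        ∑ e, ∑ e', 2 * Q.len⁻¹ *
          ((∫⁻ x in (Q.child e).toSet, w x) * ∫⁻ x in (Q.child e').toSet, w x) := by
      rw [← two_mul, ← mul_assoc, sq, setLIntegral_eq_sum_child Q w, Finset.sum_mul_sum,
        Finset.mul_sum]
      simp only [Finset.mul_sum]
    have hdiag : ∀ v : (Fin 3 → Bool) → ℝ≥0∞, ∑ e, v e = ∑ e, ∑ e', if e = e' then v e else 0 :=
      fun v => by simp
    rw [setLIntegral_setLIntegral_eq_sum_child Q hk, treeSum, add_right_comm, hsq,
      hdiag fun e => treeSum _ n (Q.child e),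
      ← Finset.sum_add_distrib, Finset.mul_sum]
    refine Finset.sum_le_sum fun e _ => ?_
    rw [← Finset.sum_add_distrib, Finset.mul_sum]
    refine Finset.sum_le_sum fun e' _ => ?_
    split_ifs with h
    · subst h
      rw [add_comm, ← inv_len_child Q e, ← sq]
      exact ih _
    · rw [add_zero]
      exact Q.two_mul_inv_len_mul_le hw (measurableSet_toSet _) (measurableSet_toSet _)
        (child_subset _ _) (child_subset _ _)

theorem energy_le_ksNorm {w : E3 → ℝ≥0∞} (hwm : Measurable w) (Q : Cell)
    (hw : ∫⁻ x in Q.toSet, w x ≠ ⊤) :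
    ∫⁻ x in Q.toSet, ∫⁻ y in Q.toSet, w x * w y / edist x y ≤
      ksNorm w * ∫⁻ x in Q.toSet, w x := by
  have hr : volume.restrict Q.toSet =
      volume.restrict (cube3 (WithLp.toLp 2 fun i => Q.corner i + Q.side / 2) Q.side) :=
    Measure.restrict_congr_set Q.toSet_ae_eq_cube3
  rcases eq_or_ne (∫⁻ x in Q.toSet, w x) 0 with h0 | h0
  · have h0' := (lintegral_eq_zero_iff hwm).1 h0
    refine le_of_eq_of_le (lintegral_eq_zero_of_ae_eq_zero (ae_of_all _ fun x => ?_)) zero_le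
    refine lintegral_eq_zero_of_ae_eq_zero (h0'.mono fun y hy => ?_)
    simp [hy]
  · have : ksRatio w (WithLp.toLp 2 fun i => Q.corner i + Q.side / 2) Q.side ≤ ksNorm w :=
      le_iSup₂_of_le _ Q.side (le_iSup_of_le Q.side_pos le_rfl)
    rw [ksRatio, ← hr, ← ENNReal.div_eq_inv_mul] at this
    exact (ENNReal.div_le_iff h0 hw).1 this

theorem treeSum_sq_le_ksNorm {w : E3 → ℝ≥0∞} (hw : Measurable w) (hwi : ∫⁻ x, w x ≠ ⊤) (n : ℕ)
    (Q : Cell) : treeSum (fun R => R.len⁻¹ * (∫⁻ x in R.toSet, w x) ^ 2) n Q ≤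
      4 * ksNorm w * ∫⁻ x in Q.toSet, w x := by
  refine le_self_add.trans ((treeSum_sq_le_energy hw n Q).trans ?_)
  rw [mul_assoc]
  gcongr
  exact energy_le_ksNorm hw Q (ne_top_of_le_ne_top hwi (setLIntegral_le_lintegral _ _))

/-- The dyadic potential of order one, truncated to the generations `0, …, n - 1`. -/
def potential (f : E3 → ℝ≥0∞) (n : ℕ) (Q : Cell) (x : E3) : ℝ≥0∞ :=
  treeSum (fun R => R.toSet.indicator
    (fun _ => R.len⁻¹ ^ 2 * ∫⁻ y in R.toSet, f y) x) n Q

theorem measurable_potential (f : E3 → ℝ≥0∞) (n : ℕ) (Q : Cell) :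
    Measurable (potential f n Q) := by
  induction n generalizing Q with
  | zero => exact measurable_const
  | succ n ih =>
    exact (measurable_const.indicator Q.measurableSet_toSet).add
      (Finset.measurable_fun_sum _ fun e _ => ih _)

theorem potential_of_notMem (f : E3 → ℝ≥0∞) (n : ℕ) {Q : Cell} {x : E3} (hx : x ∉ Q.toSet) :
    potential f n Q x = 0 := by
  induction n generalizing Q with
  | zero => rfl
  | succ n ih =>
    have : ∀ e, potential f n (Q.child e) x = 0 := fun e => ih fun h => hx (child_subset Q e h)
    simp only [potential] at this
    simp [potential, treeSum, hx, this]

theorem potential_succ_of_mem_child (f : E3 → ℝ≥0∞) (n : ℕ) {Q : Cell} {x : E3}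
    {e : Fin 3 → Bool} (hx : x ∈ (Q.child e).toSet) :
    potential f (n + 1) Q x =
      Q.len⁻¹ ^ 2 * (∫⁻ y in Q.toSet, f y) + potential f n (Q.child e) x := by
  have : ∑ e', potential f n (Q.child e') x = potential f n (Q.child e) x :=
    Finset.sum_eq_single e (fun e' _ hne => potential_of_notMem f n fun h =>
      Set.disjoint_left.1 (Q.disjoint_child hne) h hx) (by simp)
  rw [← this]
  simp [potential, treeSum, child_subset Q e hx]

theorem lintegral_potential_mul (f : E3 → ℝ≥0∞) {k : E3 → ℝ≥0∞} (hk : Measurable k) (n : ℕ)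
    (Q : Cell) : ∫⁻ x, potential f n Q x * k x =
      treeSum (fun R => R.len⁻¹ ^ 2 * (∫⁻ y in R.toSet, f y) * ∫⁻ y in R.toSet, k y) n Q := by
  induction n generalizing Q with
  | zero => simp [potential, treeSum]
  | succ n ih =>
    have h1 : ∀ x, potential f (n + 1) Q x * k x =
        Q.toSet.indicator (fun x => Q.len⁻¹ ^ 2 * (∫⁻ y in Q.toSet, f y) * k x) x
          + ∑ e, potential f n (Q.child e) x * k x := fun x => by
      simp only [potential, treeSum, add_mul, Finset.sum_mul]
      congr 1
      by_cases h : x ∈ Q.toSet <;> simp [h]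
    simp only [h1]
    rw [lintegral_add_left ((hk.const_mul _).indicator Q.measurableSet_toSet),
      lintegral_finsetSum (f := fun e x => potential f n (Q.child e) x * k x) _
        fun e _ => (measurable_potential f n _).mul hk,
      lintegral_indicator Q.measurableSet_toSet, lintegral_const_mul _ hk, treeSum]
    simp only [ih]

theorem lintegral_potential_mul_comm {f k : E3 → ℝ≥0∞} (hf : Measurable f) (hk : Measurable k)
    (n : ℕ) (Q : Cell) :
    ∫⁻ x, potential f n Q x * k x = ∫⁻ x, potential k n Q x * f x := by
  rw [lintegral_potential_mul f hk, lintegral_potential_mul k hf]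
  congr 1
  funext R
  ring

theorem setLIntegral_potential_le (h : E3 → ℝ≥0∞) (n : ℕ) (Q : Cell) :
    ∫⁻ x in Q.toSet, potential h n Q x ≤ 2 * Q.len * ∫⁻ x in Q.toSet, h x := by
  induction n generalizing Q with
  | zero => simp [potential, treeSum]
  | succ n ih =>
    have hi : Q.len⁻¹ * Q.len = 1 := ENNReal.inv_mul_cancel Q.len_ne_zero Q.len_ne_top
    have h1 : ∀ e, ∫⁻ x in (Q.child e).toSet, potential h (n + 1) Q x ≤
        Q.len⁻¹ ^ 2 * (∫⁻ y in Q.toSet, h y) * volume (Q.child e).toSet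
          + Q.len * ∫⁻ x in (Q.child e).toSet, h x := fun e => by
      rw [setLIntegral_congr_fun (measurableSet_toSet _)
        fun x hx => potential_succ_of_mem_child h n hx, lintegral_add_left measurable_const,
        setLIntegral_const, ← two_mul_len_child Q e]
      gcongr
      exact ih _
    have hvol : ∑ e, volume (Q.child e).toSet = Q.len ^ 3 := by
      rw [← volume_toSet, ← setLIntegral_one, setLIntegral_eq_sum_child]
      simp
    rw [setLIntegral_eq_sum_child Q (potential h (n + 1) Q)]
    refine (Finset.sum_le_sum fun e _ => h1 e).trans ?_
    rw [Finset.sum_add_distrib, ← Finset.mul_sum, ← Finset.mul_sum, hvol,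
      ← setLIntegral_eq_sum_child]
    refine le_of_eq ?_
    calc _ = (Q.len⁻¹ * Q.len) ^ 2 * Q.len * (∫⁻ y in Q.toSet, h y)
          + Q.len * ∫⁻ y in Q.toSet, h y := by ring
      _ = _ := by rw [hi]; ring

theorem setLIntegral_potential_sq_le (h : E3 → ℝ≥0∞) (n : ℕ) (Q : Cell) :
    ∫⁻ x in Q.toSet, potential h n Q x ^ 2 ≤
      3 * treeSum (fun R => R.len⁻¹ * (∫⁻ x in R.toSet, h x) ^ 2) n Q := by
  induction n generalizing Q with
  | zero => simp [potential, treeSum]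
  | succ n ih =>
    have hi : Q.len⁻¹ * Q.len = 1 := ENNReal.inv_mul_cancel Q.len_ne_zero Q.len_ne_top
    set a := Q.len⁻¹ ^ 2 * ∫⁻ y in Q.toSet, h y with ha
    have h1 : ∀ e, ∫⁻ x in (Q.child e).toSet, potential h (n + 1) Q x ^ 2 ≤
        a ^ 2 * volume (Q.child e).toSet + 2 * a * (Q.len * ∫⁻ x in (Q.child e).toSet, h x)
          + 3 * treeSum (fun R => R.len⁻¹ * (∫⁻ x in R.toSet, h x) ^ 2) n (Q.child e) :=
        fun e => by
      have h2 : Set.EqOn (fun x => potential h (n + 1) Q x ^ 2) (fun x => a ^ 2 +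
          (2 * a * potential h n (Q.child e) x + potential h n (Q.child e) x ^ 2))
          (Q.child e).toSet := fun x hx => by
        simp only [potential_succ_of_mem_child h n hx]
        rw [ha]
        ring
      rw [setLIntegral_congr_fun (measurableSet_toSet _) h2, lintegral_add_left measurable_const,
        lintegral_add_left ((measurable_potential _ _ _).const_mul _),
        setLIntegral_const, lintegral_const_mul _ (measurable_potential _ _ _), ← add_assoc,
        ← two_mul_len_child Q e]
      gcongr
      · exact setLIntegral_potential_le _ _ _
      · exact ih _
    have hvol : ∑ e, volume (Q.child e).toSet = Q.len ^ 3 := by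
      rw [← volume_toSet, ← setLIntegral_one, setLIntegral_eq_sum_child]
      simp
    rw [setLIntegral_eq_sum_child Q fun x => potential h (n + 1) Q x ^ 2]
    refine (Finset.sum_le_sum fun e _ => h1 e).trans ?_
    rw [Finset.sum_add_distrib, Finset.sum_add_distrib, ← Finset.mul_sum, ← Finset.mul_sum,
      ← Finset.mul_sum, ← Finset.mul_sum, hvol, ← setLIntegral_eq_sum_child, treeSum, mul_add]
    gcongr
    refine le_of_eq ?_
    rw [ha]
    calc _ = (Q.len⁻¹ * Q.len) ^ 3 * Q.len⁻¹ * (∫⁻ y in Q.toSet, h y) ^ 2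
          + 2 * (Q.len⁻¹ * Q.len) * Q.len⁻¹ * (∫⁻ y in Q.toSet, h y) ^ 2 := by ring
      _ = _ := by rw [hi]; ring

theorem exists_potential_le {f : E3 → ℝ≥0∞} (hf : ∫⁻ x, f x ≠ ⊤) (n : ℕ) (Q : Cell) :
    ∃ B : ℝ≥0, ∀ x, potential f n Q x ≤ B := by
  induction n generalizing Q with
  | zero => exact ⟨0, fun x => by simp [potential, treeSum]⟩
  | succ n ih =>
    choose B hB using ih
    have hQ : Q.len⁻¹ ^ 2 * ∫⁻ y in Q.toSet, f y ≠ ⊤ :=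
      ENNReal.mul_ne_top (by simp [len_ne_zero])
        (ne_top_of_le_ne_top hf (setLIntegral_le_lintegral _ _))
    refine ⟨(Q.len⁻¹ ^ 2 * ∫⁻ y in Q.toSet, f y).toNNReal + ∑ e, B (Q.child e), fun x => ?_⟩
    push_cast
    rw [ENNReal.coe_toNNReal hQ]
    exact add_le_add (Set.indicator_apply_le' (fun _ => le_rfl) fun _ => zero_le)
      (Finset.sum_le_sum fun e _ => hB _ _)

end Cell

theorem two_mul_mul_le_mul_sq_add {s : ℝ≥0∞} (hs0 : s ≠ 0) (hst : s ≠ ⊤) (a b : ℝ≥0∞) :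
    2 * (a * b) ≤ s * b ^ 2 + s⁻¹ * a ^ 2 := by
  rcases eq_or_ne a ⊤ with ha | ha
  · simp [ha, hst, ENNReal.mul_top]
  rcases eq_or_ne b ⊤ with hb | hb
  · simp [hb, hs0, ENNReal.mul_top]
  lift s to ℝ≥0 using hst
  lift a to ℝ≥0 using ha
  lift b to ℝ≥0 using hb
  have hs1 : s ≠ 0 := by simpa using hs0
  rw [← ENNReal.coe_inv hs1]
  norm_cast
  rw [← NNReal.coe_le_coe]
  push_cast
  have hs2 : (0 : ℝ) < s := by positivity
  have : (s : ℝ) * b ^ 2 + (s : ℝ)⁻¹ * a ^ 2 - 2 * (a * b) = (s : ℝ)⁻¹ * (s * b - a) ^ 2 := by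
    field_simp
    ring
  have h3 : 0 ≤ (s : ℝ)⁻¹ * (s * b - a) ^ 2 := by positivity
  linarith

namespace Cell

theorem lintegral_potential_sq_mul_le_of_lt {w f : E3 → ℝ≥0∞} (hw : Measurable w)
    (hf : Measurable f) (hwi : ∫⁻ x, w x ≠ ⊤) (hfi : ∫⁻ x, f x ≠ ⊤) {A : ℝ} (hA : 0 < A)
    (hwA : 4 * ksNorm w ≤ ENNReal.ofReal A) (n : ℕ) (Q : Cell) :
    ∫⁻ x, potential f n Q x ^ 2 * w x ≤ 12 * ENNReal.ofReal A * ∫⁻ x in Q.toSet, f x ^ 2 := by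
  set g := potential f n Q
  have hg : Measurable g := measurable_potential f n Q
  set X := ∫⁻ x, g x ^ 2 * w x with hX
  obtain ⟨B, hB⟩ := exists_potential_le hfi n Q
  have hXfin : X ≠ ⊤ := by
    refine ne_top_of_le_ne_top (b := (B : ℝ≥0∞) ^ 2 * ∫⁻ x, w x)
      (ENNReal.mul_ne_top (by simp) hwi) ?_
    rw [← lintegral_const_mul _ hw]
    refine lintegral_mono fun x => ?_
    gcongr
    exact hB x
  have hcarl := carleson_embedding hw hg hwi hXfin hA (fun m R =>
    (treeSum_sq_le_ksNorm hw hwi m R).trans (by gcongr)) n Q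
  set h := potential (fun x => g x * w x) n Q
  have hh : Measurable h := measurable_potential _ n Q
  have hE : ∫⁻ x in Q.toSet, h x ^ 2 ≤ 12 * ENNReal.ofReal A * X :=
    calc _ ≤ 3 * (4 * ENNReal.ofReal A * X) := by
          refine (setLIntegral_potential_sq_le _ n Q).trans ?_
          gcongr
          exact hcarl.trans (by gcongr; exact setLIntegral_le_lintegral _ _)
      _ = _ := by ring
  have hXe : X = ∫⁻ x in Q.toSet, h x * f x := by
    rw [← lintegral_indicator Q.measurableSet_toSet, Set.indicator_eq_self.2]
    · refine Eq.trans ?_ (lintegral_potential_mul_comm (k := fun x => g x * w x) hf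
        (hg.mul hw) n Q)
      exact lintegral_congr fun x => by simp only [g]; ring
    · intro x hx
      by_contra hx'
      exact hx (by simp [h, potential_of_notMem _ n hx'])
  set s := 12 * ENNReal.ofReal A with hs
  have hs0 : s ≠ 0 := by simp [hs, hA]
  have hst : s ≠ ⊤ := by rw [hs]; finiteness
  have hsi : s * s⁻¹ = 1 := ENNReal.mul_inv_cancel hs0 hst
  have h2X : X + X ≤ s * (∫⁻ x in Q.toSet, f x ^ 2) + X := by
    calc X + X = ∫⁻ x in Q.toSet, 2 * (h x * f x) := by
          rw [lintegral_const_mul (f := fun x => h x * f x) _ (hh.mul hf), ← two_mul, hXe]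
      _ ≤ ∫⁻ x in Q.toSet, (s * f x ^ 2 + s⁻¹ * h x ^ 2) :=
          lintegral_mono fun x => two_mul_mul_le_mul_sq_add hs0 hst _ _
      _ = s * (∫⁻ x in Q.toSet, f x ^ 2) + s⁻¹ * ∫⁻ x in Q.toSet, h x ^ 2 := by
          rw [lintegral_add_left ((hf.pow_const 2).const_mul _),
            lintegral_const_mul _ (hf.pow_const 2), lintegral_const_mul _ (hh.pow_const 2)]
      _ ≤ s * (∫⁻ x in Q.toSet, f x ^ 2) + s⁻¹ * (s * X) := by gcongr
      _ = _ := by rw [← mul_assoc, mul_comm s⁻¹, hsi, one_mul]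
  exact (ENNReal.add_le_add_iff_right hXfin).1 h2X

/-- The trace inequality for the dyadic potential under the Kerman–Sawyer condition. -/
theorem lintegral_potential_sq_mul_le {w f : E3 → ℝ≥0∞} (hw : Measurable w)
    (hf : Measurable f) (hwi : ∫⁻ x, w x ≠ ⊤) (hfi : ∫⁻ x, f x ≠ ⊤) (hN : ksNorm w ≠ ⊤) (n : ℕ)
    (Q : Cell) (hf2 : ∫⁻ x in Q.toSet, f x ^ 2 ≠ ⊤) :
    ∫⁻ x, potential f n Q x ^ 2 * w x ≤ 48 * ksNorm w * ∫⁻ x in Q.toSet, f x ^ 2 := by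
  set N := (ksNorm w).toReal with hNr
  have hNN : ksNorm w = ENNReal.ofReal N := (ENNReal.ofReal_toReal hN).symm
  have hN0 : 0 ≤ N := toReal_nonneg
  have h4 : (4 : ℝ≥0∞) * ksNorm w = ENNReal.ofReal (4 * N) := by
    rw [hNN, ENNReal.ofReal_mul (by norm_num)]; simp
  have hlim : Tendsto (fun A : ℝ => 12 * ENNReal.ofReal A * ∫⁻ x in Q.toSet, f x ^ 2)
      (nhdsWithin (4 * N) (Set.Ioi (4 * N)))
      (nhds (12 * ENNReal.ofReal (4 * N) * ∫⁻ x in Q.toSet, f x ^ 2)) := by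
    refine ENNReal.Tendsto.mul_const (ENNReal.Tendsto.const_mul ?_ (Or.inr (by simp))) (Or.inr hf2)
    exact (ENNReal.tendsto_ofReal tendsto_id).mono_left nhdsWithin_le_nhds
  have h48 : (48 : ℝ≥0∞) * ksNorm w = 12 * ENNReal.ofReal (4 * N) := by
    rw [← h4, ← mul_assoc]; norm_num
  rw [h48]
  refine ge_of_tendsto hlim (eventually_nhdsWithin_of_forall fun A hA => ?_)
  have hA' : 4 * N < A := hA
  exact lintegral_potential_sq_mul_le_of_lt hw hf hwi hfi (by linarith)
    (h4 ▸ ENNReal.ofReal_le_ofReal hA'.le) n Q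

end Cell

theorem lintegral_comp_add_smul_le {F : E3 → ℝ≥0∞} (hF : Measurable F) (v : E3) {t : ℝ}
    (ht : 1 / 2 ≤ t) : ∫⁻ y, F (v + t • y) ≤ 8 * ∫⁻ y, F y := by
  have ht0 : t ≠ 0 := by linarith
  have hm : Measurable fun y : E3 => F (v + y) := by fun_prop
  have h1 : ∫⁻ y, F (v + t • y) = ∫⁻ y, F (v + y) ∂(Measure.map (t • ·) (volume : Measure E3)) :=
    (lintegral_map hm (by fun_prop)).symm
  rw [h1, Measure.map_addHaar_smul _ ht0, lintegral_smul_measure,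
    lintegral_add_left_eq_self F v, smul_eq_mul]
  gcongr
  have : (8 : ℝ≥0∞) = ENNReal.ofReal 8 := by simp
  rw [this]
  refine ENNReal.ofReal_le_ofReal ?_
  have h2 : Module.finrank ℝ E3 = 3 := by simp
  rw [h2, abs_of_nonneg (by positivity), inv_le_comm₀ (by positivity) (by norm_num)]
  calc (8 : ℝ)⁻¹ = (1 / 2) ^ 3 := by norm_num
    _ ≤ t ^ 3 := by gcongr

namespace Cell

theorem setLIntegral_setLIntegral_convexComb_le_of_half_le (Q : Cell) {F : E3 → ℝ≥0∞}
    (hF : Measurable F) {t : ℝ} (ht : 1 / 2 ≤ t) (ht1 : t ≤ 1) :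
    ∫⁻ x in Q.toSet, ∫⁻ y in Q.toSet, F (x + t • (y - x)) ≤
      8 * Q.len ^ 3 * ∫⁻ x in Q.toSet, F x := by
  have hQ := Q.measurableSet_toSet
  have key : ∀ x ∈ Q.toSet, ∫⁻ y in Q.toSet, F (x + t • (y - x)) ≤
      8 * ∫⁻ x in Q.toSet, F x := by
    intro x hx
    rw [← lintegral_indicator hQ, ← lintegral_indicator hQ]
    refine le_trans (lintegral_mono fun y => ?_)
      (lintegral_comp_add_smul_le (hF.indicator hQ) ((1 - t) • x) ht)
    refine Set.indicator_apply_le' (fun hy => ?_) fun _ => zero_le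
    have e : x + t • (y - x) = (1 - t) • x + t • y := by module
    have hmem : (1 - t) • x + t • y ∈ Q.toSet :=
      Q.convex_toSet hx hy (by linarith) (by linarith) (by ring)
    rw [Set.indicator_of_mem hmem, e]
  refine (setLIntegral_mono' hQ key).trans ?_
  rw [setLIntegral_const, volume_toSet]
  exact le_of_eq (by ring)

theorem setLIntegral_setLIntegral_convexComb_le (Q : Cell) {F : E3 → ℝ≥0∞}
    (hF : Measurable F) {t : ℝ} (ht : t ∈ Set.Icc (0 : ℝ) 1) :
    ∫⁻ x in Q.toSet, ∫⁻ y in Q.toSet, F (x + t • (y - x)) ≤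
      8 * Q.len ^ 3 * ∫⁻ x in Q.toSet, F x := by
  rcases le_total (1 / 2) t with h | h
  · exact Q.setLIntegral_setLIntegral_convexComb_le_of_half_le hF h ht.2
  · rw [lintegral_lintegral_swap (by unfold Function.uncurry; fun_prop)]
    have := Q.setLIntegral_setLIntegral_convexComb_le_of_half_le hF (t := 1 - t)
      (by linarith) (by linarith [ht.1])
    refine le_trans (le_of_eq ?_) this
    refine lintegral_congr fun x => lintegral_congr fun y => ?_
    congr 1
    module

theorem enorm_sub_le_lintegral_segment {ψ : E3 → ℂ} (hψ : ContDiff ℝ 1 ψ) (x y : E3) :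
    ‖ψ x - ψ y‖ₑ ≤
      edist x y * ∫⁻ t in Set.Icc (0 : ℝ) 1, ‖fderiv ℝ ψ (x + t • (y - x))‖ₑ := by
  have hγ : ContDiff ℝ 1 fun t : ℝ => ψ (x + t • (y - x)) := by fun_prop
  have h := enorm_sub_le_lintegral_deriv_of_contDiffOn_Icc hγ.contDiffOn zero_le_one
  simp only [one_smul, zero_smul, add_zero, add_sub_cancel] at h
  rw [← edist_eq_enorm_sub, edist_comm, edist_eq_enorm_sub]
  refine h.trans ?_
  rw [← lintegral_const_mul' _ _ (edist_ne_top x y)]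
  refine lintegral_mono fun t => ?_
  have hd : HasDerivAt (fun t : ℝ => ψ (x + t • (y - x)))
      (fderiv ℝ ψ (x + t • (y - x)) (y - x)) t := by
    have h1 : HasDerivAt (fun t : ℝ => x + t • (y - x)) (y - x) t := by
      simpa using ((hasDerivAt_id t).smul_const (y - x)).const_add x
    exact ((hψ.differentiable one_ne_zero) _).hasFDerivAt.comp_hasDerivAt t h1
  rw [hd.deriv, edist_comm, edist_eq_enorm_sub, mul_comm]
  exact ContinuousLinearMap.le_opENorm _ _

theorem setLIntegral_setLIntegral_enorm_sub_le (Q : Cell) {ψ : E3 → ℂ} (hψ : ContDiff ℝ 1 ψ) :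
    ∫⁻ x in Q.toSet, ∫⁻ y in Q.toSet, ‖ψ x - ψ y‖ₑ ≤
      16 * Q.len ^ 4 * ∫⁻ x in Q.toSet, ‖fderiv ℝ ψ x‖ₑ := by
  have hQ := Q.measurableSet_toSet
  have hc : Continuous (fderiv ℝ ψ) := hψ.continuous_fderiv one_ne_zero
  have hF : Measurable fun x => ‖fderiv ℝ ψ x‖ₑ := hc.enorm.measurable
  have hl : (2 : ℝ≥0∞) * Q.len ≠ ⊤ := ENNReal.mul_ne_top (by simp) Q.len_ne_top
  have m2 : ∀ x : E3, Measurable fun p : ℝ × E3 => ‖fderiv ℝ ψ (x + p.1 • (p.2 - x))‖ₑ :=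
    fun x => hF.comp (by fun_prop)
  have m3 : Measurable fun p : (E3 × ℝ) × E3 =>
      ‖fderiv ℝ ψ (p.1.1 + p.1.2 • (p.2 - p.1.1))‖ₑ := hF.comp (by fun_prop)
  calc ∫⁻ x in Q.toSet, ∫⁻ y in Q.toSet, ‖ψ x - ψ y‖ₑ
      ≤ ∫⁻ x in Q.toSet, ∫⁻ y in Q.toSet, 2 * Q.len *
          ∫⁻ t in Set.Icc (0 : ℝ) 1, ‖fderiv ℝ ψ (x + t • (y - x))‖ₑ := by
        refine setLIntegral_mono' hQ fun x hx => setLIntegral_mono' hQ fun y hy => ?_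
        refine (enorm_sub_le_lintegral_segment hψ x y).trans ?_
        gcongr
        exact edist_le hx hy
    _ = 2 * Q.len * ∫⁻ t in Set.Icc (0 : ℝ) 1, ∫⁻ x in Q.toSet, ∫⁻ y in Q.toSet,
          ‖fderiv ℝ ψ (x + t • (y - x))‖ₑ := by
        simp only [lintegral_const_mul' _ _ hl]
        congr 1
        symm
        rw [lintegral_lintegral_swap]
        · exact lintegral_congr fun x => lintegral_lintegral_swap (m2 x).aemeasurable
        · have := m3.lintegral_prod_right' (ν := volume.restrict Q.toSet)
          exact (this.comp measurable_swap).aemeasurable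
    _ ≤ 2 * Q.len * ∫⁻ t in Set.Icc (0 : ℝ) 1, 8 * Q.len ^ 3 *
          ∫⁻ x in Q.toSet, ‖fderiv ℝ ψ x‖ₑ := by
        gcongr 2 * Q.len * ?_
        exact setLIntegral_mono' measurableSet_Icc fun t ht =>
          Q.setLIntegral_setLIntegral_convexComb_le hF ht
    _ = _ := by
        rw [setLIntegral_const, Real.volume_Icc]
        simp only [sub_zero, ENNReal.ofReal_one, mul_one]
        ring

theorem enorm_sub_average_le (Q : Cell) {ψ : E3 → ℂ} (hψ : IntegrableOn ψ Q.toSet) (a : ℂ) :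
    ‖a - ⨍ y in Q.toSet, ψ y‖ₑ ≤ (Q.len ^ 3)⁻¹ * ∫⁻ y in Q.toSet, ‖a - ψ y‖ₑ := by
  have h0 : volume Q.toSet ≠ 0 := by simp [volume_toSet, len_ne_zero]
  have ht : volume Q.toSet ≠ ⊤ := by simp [volume_toSet, len_ne_top]
  have hi : (volume Q.toSet)⁻¹ ≠ ⊤ := ENNReal.inv_ne_top.2 h0
  set μ := (volume Q.toSet)⁻¹ • volume.restrict Q.toSet with hμ
  have hp : IsProbabilityMeasure μ := ⟨by simp [hμ, ENNReal.inv_mul_cancel h0 ht]⟩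
  have e1 : ⨍ y in Q.toSet, ψ y = ∫ y, ψ y ∂μ := by
    rw [average_eq', Measure.restrict_apply_univ]
  have e2 : a - ∫ y, ψ y ∂μ = ∫ y, (a - ψ y) ∂μ := by
    rw [integral_sub (integrable_const a) (hψ.smul_measure hi)]
    simp only [integral_const, probReal_univ, one_smul]
    rfl
  rw [e1, e2]
  refine (enorm_integral_le_lintegral_enorm _).trans ?_
  rw [hμ, lintegral_smul_measure, smul_eq_mul, volume_toSet]

theorem enorm_average_child_sub_le (Q : Cell) (e : Fin 3 → Bool) {ψ : E3 → ℂ}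
    (hψ : ContDiff ℝ 1 ψ) (hi : Integrable ψ) :
    ‖(⨍ y in (Q.child e).toSet, ψ y) - ⨍ y in Q.toSet, ψ y‖ₑ ≤
      128 * (Q.len⁻¹ ^ 2 * ∫⁻ y in Q.toSet, ‖fderiv ℝ ψ y‖ₑ) := by
  have hil : Q.len⁻¹ * Q.len = 1 := ENNReal.inv_mul_cancel Q.len_ne_zero Q.len_ne_top
  have hne : ((Q.child e).len ^ 3)⁻¹ ≠ ⊤ := by simp [len_ne_zero]
  have hne' : (Q.len ^ 3)⁻¹ ≠ ⊤ := by simp [len_ne_zero]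
  rw [← edist_eq_enorm_sub, edist_comm, edist_eq_enorm_sub]
  calc _ ≤ ((Q.child e).len ^ 3)⁻¹ * ∫⁻ y in (Q.child e).toSet, ‖(⨍ z in Q.toSet, ψ z) - ψ y‖ₑ :=
        enorm_sub_average_le _ hi.integrableOn _
    _ ≤ ((Q.child e).len ^ 3)⁻¹ * ∫⁻ y in (Q.child e).toSet,
          (Q.len ^ 3)⁻¹ * ∫⁻ x in Q.toSet, ‖ψ y - ψ x‖ₑ := by
        gcongr with y
        rw [← edist_eq_enorm_sub, edist_comm, edist_eq_enorm_sub]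
        exact enorm_sub_average_le _ hi.integrableOn _
    _ ≤ ((Q.child e).len ^ 3)⁻¹ * ((Q.len ^ 3)⁻¹ * ∫⁻ y in Q.toSet,
          ∫⁻ x in Q.toSet, ‖ψ y - ψ x‖ₑ) := by
        rw [lintegral_const_mul' _ _ hne']
        gcongr
        exact child_subset Q e
    _ ≤ ((Q.child e).len ^ 3)⁻¹ * ((Q.len ^ 3)⁻¹ *
          (16 * Q.len ^ 4 * ∫⁻ x in Q.toSet, ‖fderiv ℝ ψ x‖ₑ)) := by
        gcongr
        exact Q.setLIntegral_setLIntegral_enorm_sub_le hψ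
    _ = (Q.len⁻¹ * Q.len) ^ 4 *
          (128 * (Q.len⁻¹ ^ 2 * ∫⁻ y in Q.toSet, ‖fderiv ℝ ψ y‖ₑ)) := by
        rw [ENNReal.inv_pow, ENNReal.inv_pow, inv_len_child]
        ring
    _ = _ := by rw [hil, one_pow, one_mul]

theorem enorm_sub_average_le_potential {ψ : E3 → ℂ} (hψ : ContDiff ℝ 1 ψ) (hi : Integrable ψ)
    {K : ℝ≥0} (hK : LipschitzWith K ψ) (n : ℕ) (Q : Cell) {x : E3} (hx : x ∈ Q.toSet) :
    ‖ψ x - ⨍ y in Q.toSet, ψ y‖ₑ ≤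
      128 * potential (fun y => ‖fderiv ℝ ψ y‖ₑ) n Q x + 2 * K * Q.len * 2⁻¹ ^ n := by
  induction n generalizing Q with
  | zero =>
    refine (enorm_sub_average_le Q hi.integrableOn _).trans ?_
    have hil : Q.len⁻¹ * Q.len = 1 := ENNReal.inv_mul_cancel Q.len_ne_zero Q.len_ne_top
    calc _ ≤ (Q.len ^ 3)⁻¹ * ∫⁻ y in Q.toSet, K * (2 * Q.len) := by
          gcongr (Q.len ^ 3)⁻¹ * ?_
          refine setLIntegral_mono' Q.measurableSet_toSet fun y hy => ?_
          rw [← edist_eq_enorm_sub]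
          refine (hK x y).trans ?_
          gcongr
          exact edist_le hx hy
      _ = (Q.len⁻¹ * Q.len) ^ 3 * (2 * K * Q.len) := by
          rw [setLIntegral_const, volume_toSet, ENNReal.inv_pow]
          ring
      _ ≤ _ := by rw [hil]; simp
  | succ n ih =>
    obtain ⟨e, he⟩ := Set.mem_iUnion.1 (Q.iUnion_child ▸ hx)
    have h1 := ih (Q.child e) he
    have h2 := Q.enorm_average_child_sub_le e hψ hi
    rw [potential_succ_of_mem_child _ n he]
    calc _ = ‖((⨍ y in (Q.child e).toSet, ψ y) - ⨍ y in Q.toSet, ψ y) +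
            (ψ x - ⨍ y in (Q.child e).toSet, ψ y)‖ₑ := by congr 1; ring
      _ ≤ _ := enorm_add_le _ _
      _ ≤ _ := add_le_add h2 h1
      _ = _ := by
          rw [← two_mul_len_child Q e, pow_succ]
          have h3 : (2 : ℝ≥0∞) * 2⁻¹ = 1 := ENNReal.mul_inv_cancel (by simp) (by simp)
          calc _ = 128 * ((2 * (Q.child e).len)⁻¹ ^ 2 * (∫⁻ y in Q.toSet, ‖fderiv ℝ ψ y‖ₑ)
                + potential (fun y => ‖fderiv ℝ ψ y‖ₑ) n (Q.child e) x)
                + 2 * K * (Q.child e).len * 2⁻¹ ^ n * 1 := by ring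
            _ = _ := by rw [← h3]; ring

theorem enorm_average_sq_le (Q : Cell) {ψ : E3 → ℂ} (hψ : AEMeasurable ψ) :
    ‖⨍ y in Q.toSet, ψ y‖ₑ ^ 2 ≤ (Q.len ^ 3)⁻¹ * ∫⁻ y in Q.toSet, ‖ψ y‖ₑ ^ 2 := by
  have h0 : volume Q.toSet ≠ 0 := by simp [volume_toSet, len_ne_zero]
  have ht : volume Q.toSet ≠ ⊤ := by simp [volume_toSet, len_ne_top]
  set μ := (volume Q.toSet)⁻¹ • volume.restrict Q.toSet with hμ
  have hp : IsProbabilityMeasure μ := ⟨by simp [hμ, ENNReal.inv_mul_cancel h0 ht]⟩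
  have e1 : ⨍ y in Q.toSet, ψ y = ∫ y, ψ y ∂μ := by
    rw [average_eq', Measure.restrict_apply_univ]
  have hm : AEMeasurable (fun y => ‖ψ y‖ₑ) μ := (hψ.restrict.smul_measure _).enorm
  have hol := ENNReal.lintegral_mul_le_Lp_mul_Lq μ Real.HolderConjugate.two_two hm
    (aemeasurable_const (b := (1 : ℝ≥0∞)))
  have h2 : ∫⁻ y, ‖ψ y‖ₑ ^ 2 ∂μ = (Q.len ^ 3)⁻¹ * ∫⁻ y in Q.toSet, ‖ψ y‖ₑ ^ 2 := by
    rw [hμ, lintegral_smul_measure, smul_eq_mul, volume_toSet]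
  rw [e1, ← h2]
  simp only [Pi.mul_apply, mul_one, lintegral_const, ENNReal.one_rpow, measure_univ,
    ENNReal.rpow_two, one_pow] at hol
  calc _ ≤ ((∫⁻ y, ‖ψ y‖ₑ ^ 2 ∂μ) ^ (1 / 2 : ℝ)) ^ 2 :=
        pow_le_pow_left' ((enorm_integral_le_lintegral_enorm _).trans hol) 2
    _ = _ := by
        rw [← ENNReal.rpow_natCast, ← ENNReal.rpow_mul]
        norm_num

end Cell

theorem ENNReal.add_add_sq_le (a b c : ℝ≥0∞) :
    (a + b + c) ^ 2 ≤ 3 * a ^ 2 + 3 * b ^ 2 + 3 * c ^ 2 := by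
  have h : ∀ a b : ℝ≥0∞, 2 * (a * b) ≤ b ^ 2 + a ^ 2 := fun a b => by
    simpa using two_mul_mul_le_mul_sq_add one_ne_zero one_ne_top a b
  calc (a + b + c) ^ 2 = a ^ 2 + b ^ 2 + c ^ 2 + 2 * (a * b) + 2 * (a * c) + 2 * (b * c) := by ring
    _ ≤ a ^ 2 + b ^ 2 + c ^ 2 + (b ^ 2 + a ^ 2) + (c ^ 2 + a ^ 2) + (c ^ 2 + b ^ 2) := by
      gcongr <;> exact h _ _
    _ = _ := by ring

namespace Cell

theorem setLIntegral_enorm_sq_mul_le (Q : Cell) {w : E3 → ℝ≥0∞} (hw : Measurable w)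
    (hwi : ∫⁻ x, w x ≠ ⊤) (hN : ksNorm w ≠ ⊤) {ψ : E3 → ℂ} (hψ : ContDiff ℝ 1 ψ)
    (hs : HasCompactSupport ψ) :
    ∫⁻ x in Q.toSet, ‖ψ x‖ₑ ^ 2 * w x ≤
      2359296 * ksNorm w * (∫⁻ x in Q.toSet, ‖fderiv ℝ ψ x‖ₑ ^ 2) +
      3 * (Q.len ^ 3)⁻¹ * (∫⁻ x in Q.toSet, w x) * ∫⁻ x in Q.toSet, ‖ψ x‖ₑ ^ 2 := by
  have hQ := Q.measurableSet_toSet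
  have hc : Continuous (fderiv ℝ ψ) := hψ.continuous_fderiv one_ne_zero
  have hcs : HasCompactSupport (fderiv ℝ ψ) := hs.fderiv ℝ
  have hi : Integrable ψ := hψ.continuous.integrable_of_hasCompactSupport hs
  obtain ⟨K, hK⟩ := hψ.lipschitzWith_of_hasCompactSupport hs one_ne_zero
  set f : E3 → ℝ≥0∞ := fun x => ‖fderiv ℝ ψ x‖ₑ with hfdef
  have hf : Measurable f := hc.enorm.measurable
  have hfi : ∫⁻ x, f x ≠ ⊤ := (hc.integrable_of_hasCompactSupport hcs).hasFiniteIntegral.ne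
  have hf2 : ∫⁻ x in Q.toSet, f x ^ 2 ≠ ⊤ := by
    have h2 : MemLp (fderiv ℝ ψ) 2 volume := hc.memLp_of_hasCompactSupport hcs
    have h3 := (lintegral_rpow_enorm_lt_top_of_eLpNorm_lt_top two_ne_zero ofNat_ne_top h2.2).ne
    simp only [ENNReal.toReal_ofNat, ENNReal.rpow_two] at h3
    exact ne_top_of_le_ne_top h3 (setLIntegral_le_lintegral _ _)
  set a := ⨍ y in Q.toSet, ψ y with ha
  set S := ∫⁻ x in Q.toSet, w x with hS
  have hSfin : S ≠ ⊤ := ne_top_of_le_ne_top hwi (setLIntegral_le_lintegral _ _)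
  have step : ∀ n : ℕ, ∫⁻ x in Q.toSet, ‖ψ x‖ₑ ^ 2 * w x ≤
      (3 * ‖a‖ₑ ^ 2 * S + 2359296 * ksNorm w * ∫⁻ x in Q.toSet, f x ^ 2) +
        3 * (2 * K * Q.len * 2⁻¹ ^ n) ^ 2 * S := by
    intro n
    have hp : Measurable (potential f n Q) := measurable_potential f n Q
    have hpw : Measurable fun x => potential f n Q x ^ 2 * w x := (hp.pow_const 2).mul hw
    calc ∫⁻ x in Q.toSet, ‖ψ x‖ₑ ^ 2 * w x
        ≤ ∫⁻ x in Q.toSet, (3 * ‖a‖ₑ ^ 2 * w x + 49152 * (potential f n Q x ^ 2 * w x) +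
            3 * (2 * K * Q.len * 2⁻¹ ^ n) ^ 2 * w x) := by
          refine setLIntegral_mono' hQ fun x hx => ?_
          have h1 : ‖ψ x‖ₑ ≤ ‖a‖ₑ + 128 * potential f n Q x + 2 * K * Q.len * 2⁻¹ ^ n := by
            calc ‖ψ x‖ₑ = ‖a + (ψ x - a)‖ₑ := by congr 1; ring
              _ ≤ ‖a‖ₑ + ‖ψ x - a‖ₑ := enorm_add_le _ _
              _ ≤ _ := by
                rw [add_assoc]
                gcongr
                exact enorm_sub_average_le_potential hψ hi hK n Q hx
          calc ‖ψ x‖ₑ ^ 2 * w x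
              ≤ (‖a‖ₑ + 128 * potential f n Q x + 2 * K * Q.len * 2⁻¹ ^ n) ^ 2 * w x := by gcongr
            _ ≤ (3 * ‖a‖ₑ ^ 2 + 3 * (128 * potential f n Q x) ^ 2 +
                  3 * (2 * K * Q.len * 2⁻¹ ^ n) ^ 2) * w x := by
                gcongr
                exact ENNReal.add_add_sq_le _ _ _
            _ = _ := by ring
      _ = 3 * ‖a‖ₑ ^ 2 * S + 49152 * (∫⁻ x in Q.toSet, potential f n Q x ^ 2 * w x) +
            3 * (2 * K * Q.len * 2⁻¹ ^ n) ^ 2 * S := by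
          rw [lintegral_add_right _ (hw.const_mul _), lintegral_add_left (hw.const_mul _),
            lintegral_const_mul _ hw, lintegral_const_mul _ hpw, lintegral_const_mul _ hw]
      _ ≤ 3 * ‖a‖ₑ ^ 2 * S + 49152 * (48 * ksNorm w * ∫⁻ x in Q.toSet, f x ^ 2) +
            3 * (2 * K * Q.len * 2⁻¹ ^ n) ^ 2 * S := by
          gcongr
          exact (setLIntegral_le_lintegral _ _).trans
            (lintegral_potential_sq_mul_le hw hf hwi hfi hN n Q hf2)
      _ = _ := by ring
  have hK' : 2 * (K : ℝ≥0∞) * Q.len ≠ ⊤ :=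
    ENNReal.mul_ne_top (ENNReal.mul_ne_top ofNat_ne_top coe_ne_top) Q.len_ne_top
  have hlim : Tendsto (fun n : ℕ =>
      (3 * ‖a‖ₑ ^ 2 * S + 2359296 * ksNorm w * ∫⁻ x in Q.toSet, f x ^ 2) +
        3 * (2 * K * Q.len * 2⁻¹ ^ n) ^ 2 * S) atTop
      (nhds ((3 * ‖a‖ₑ ^ 2 * S + 2359296 * ksNorm w * ∫⁻ x in Q.toSet, f x ^ 2) +
        3 * (2 * K * Q.len * 0) ^ 2 * S)) := by
    have h0 := ENNReal.tendsto_pow_atTop_nhds_zero_of_lt_one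
      (ENNReal.inv_lt_one.2 ENNReal.one_lt_two)
    refine Tendsto.const_add _ (ENNReal.Tendsto.mul_const (ENNReal.Tendsto.const_mul
      (ENNReal.Tendsto.pow (ENNReal.Tendsto.const_mul h0 (Or.inr hK')))
      (Or.inr ofNat_ne_top)) (Or.inr hSfin))
  refine (ge_of_tendsto' hlim step).trans ?_
  calc _ = 2359296 * ksNorm w * (∫⁻ x in Q.toSet, f x ^ 2) + 3 * ‖a‖ₑ ^ 2 * S := by ring
    _ ≤ 2359296 * ksNorm w * (∫⁻ x in Q.toSet, f x ^ 2) +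
        3 * ((Q.len ^ 3)⁻¹ * ∫⁻ y in Q.toSet, ‖ψ y‖ₑ ^ 2) * S := by
      gcongr
      exact Q.enorm_average_sq_le hi.aestronglyMeasurable.aemeasurable
    _ = _ := by ring

end Cell

/-- The fundamental cell as a dyadic cube. -/
def fundamentalCell : Cell := ⟨0, 2 * π, two_pi_pos⟩

theorem toSet_fundamentalCell : fundamentalCell.toSet = Ω3 := by
  simp [fundamentalCell, Cell.toSet, Ω3]

theorem measurableSet_Ω3 : MeasurableSet Ω3 :=
  toSet_fundamentalCell ▸ fundamentalCell.measurableSet_toSet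

theorem setLIntegral_Ω3_enorm_sq_mul_le {W : E3 → ℝ} (hW : Measurable W)
    (hWi : IntegrableOn W Ω3) (hN : ksNorm (fun x => ‖Set.indicator Ω3 W x‖ₑ) ≠ ⊤)
    {ψ : E3 → ℂ} (hψ : ContDiff ℝ 1 ψ) (hs : HasCompactSupport ψ) :
    ∫⁻ x in Ω3, ‖ψ x‖ₑ ^ 2 * ‖W x‖ₑ ≤
      2359296 * ksNorm (fun x => ‖Set.indicator Ω3 W x‖ₑ) *
        (∫⁻ x in Ω3, ‖fderiv ℝ ψ x‖ₑ ^ 2) +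
      2359296 * (∫⁻ x in Ω3, ‖W x‖ₑ) * ∫⁻ x in Ω3, ‖ψ x‖ₑ ^ 2 := by
  have hw : Measurable fun x => ‖Set.indicator Ω3 W x‖ₑ := (hW.indicator measurableSet_Ω3).enorm
  have hwi : ∫⁻ x, ‖Set.indicator Ω3 W x‖ₑ = ∫⁻ x in Ω3, ‖W x‖ₑ := by
    simp only [enorm_indicator_eq_indicator_enorm]
    exact lintegral_indicator measurableSet_Ω3 _
  have hcell := fundamentalCell.setLIntegral_enorm_sq_mul_le hw
    (by rw [hwi]; exact hWi.hasFiniteIntegral.ne) hN hψ hs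
  have h1 : (fundamentalCell.len ^ 3)⁻¹ ≤ 1 := by
    rw [ENNReal.inv_le_one]
    refine one_le_pow₀ ?_
    rw [Cell.len, ENNReal.one_le_ofReal]
    have := Real.pi_gt_three
    simp only [fundamentalCell]
    linarith
  rw [toSet_fundamentalCell] at hcell
  have e1 : ∫⁻ x in Ω3, ‖ψ x‖ₑ ^ 2 * ‖Set.indicator Ω3 W x‖ₑ =
      ∫⁻ x in Ω3, ‖ψ x‖ₑ ^ 2 * ‖W x‖ₑ :=
    setLIntegral_congr_fun measurableSet_Ω3 fun x hx => by simp [Set.indicator_of_mem hx]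
  have e2 : ∫⁻ x in Ω3, ‖Set.indicator Ω3 W x‖ₑ = ∫⁻ x in Ω3, ‖W x‖ₑ :=
    setLIntegral_congr_fun measurableSet_Ω3 fun x hx => by simp [Set.indicator_of_mem hx]
  rw [e1, e2] at hcell
  refine hcell.trans ?_
  gcongr
  calc 3 * (fundamentalCell.len ^ 3)⁻¹ ≤ 3 * 1 := by gcongr
    _ ≤ 2359296 := by norm_num

/-- The lattice vector `2πn`. -/
def latticeVec (n : Fin 3 → ℤ) : E3 := WithLp.toLp 2 fun i => 2 * π * n i

theorem lintegral_eq_tsum_setLIntegral_Ω3 (g : E3 → ℝ≥0∞) :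
    ∫⁻ x, g x = ∑' n, ∫⁻ x in Ω3, g (x + latticeVec n) := by
  have hmem : ∀ (n : Fin 3 → ℤ) (x : E3), x - latticeVec n ∈ Ω3 ↔ ∀ i, ⌊x i / (2 * π)⌋ = n i := by
    intro n x
    refine forall_congr' fun i => ?_
    have hp := two_pi_pos
    rw [Int.floor_eq_iff, le_div_iff₀ hp, div_lt_iff₀ hp]
    simp only [latticeVec, PiLp.sub_apply]
    constructor <;> rintro ⟨h1, h2⟩ <;> constructor <;> linarith
  have hmeas : ∀ n, MeasurableSet ((fun x => x - latticeVec n) ⁻¹' Ω3) := fun n =>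
    measurableSet_Ω3.preimage (by fun_prop)
  have hcover : ⋃ n, (fun x => x - latticeVec n) ⁻¹' Ω3 = Set.univ :=
    Set.eq_univ_of_forall fun x =>
      Set.mem_iUnion.2 ⟨fun i => ⌊x i / (2 * π)⌋, (hmem _ x).2 fun _ => rfl⟩
  have hdisj : Pairwise fun m n => Disjoint ((fun x => x - latticeVec m) ⁻¹' Ω3)
      ((fun x => x - latticeVec n) ⁻¹' Ω3) := fun m n hmn =>
    Set.disjoint_left.2 fun x hm hn =>
      hmn (funext fun i => ((hmem m x).1 hm i).symm.trans ((hmem n x).1 hn i))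
  rw [← setLIntegral_univ, ← hcover, lintegral_iUnion hmeas hdisj]
  refine tsum_congr fun n => ?_
  rw [← (measurePreserving_sub_right volume (latticeVec n)).setLIntegral_comp_preimage_emb
    (MeasurableEquiv.subRight (latticeVec n)).measurableEmbedding
    (fun x => g (x + latticeVec n)) Ω3]
  simp

/-- Global form bound for a periodic weight:
`∫_{ℝ³} |ψ|²|W| ≤ C‖Wχ_Ω‖_F ∫_{ℝ³} |∇ψ|² + C (∫_Ω |W|)(∫_{ℝ³} |ψ|²)`. -/
theorem stmt4 :
    ∃ C : ℝ≥0, 0 < C ∧ ∀ W : E3 → ℝ, Measurable W → Periodic3 W → IntegrableOn W Ω3 →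
      ksNorm (fun x => (‖Set.indicator Ω3 W x‖₊ : ℝ≥0∞)) < ⊤ →
      ∀ ψ : E3 → ℂ, ContDiff ℝ 1 ψ → HasCompactSupport ψ →
        (∫⁻ x, (‖ψ x‖₊ : ℝ≥0∞) ^ 2 * (‖W x‖₊ : ℝ≥0∞)) ≤
          C * ksNorm (fun x => (‖Set.indicator Ω3 W x‖₊ : ℝ≥0∞)) *
              (∫⁻ x, (‖fderiv ℝ ψ x‖₊ : ℝ≥0∞) ^ 2)
          + C * (∫⁻ x in Ω3, (‖W x‖₊ : ℝ≥0∞)) * (∫⁻ x, (‖ψ x‖₊ : ℝ≥0∞) ^ 2) := by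
  refine ⟨2359296, by norm_num, fun W hW hper hWi hN ψ hψ hs => ?_⟩
  simp only [← enorm_eq_nnnorm, ENNReal.coe_ofNat] at hN ⊢
  rw [lintegral_eq_tsum_setLIntegral_Ω3,
    lintegral_eq_tsum_setLIntegral_Ω3 fun x => ‖fderiv ℝ ψ x‖ₑ ^ 2,
    lintegral_eq_tsum_setLIntegral_Ω3 fun x => ‖ψ x‖ₑ ^ 2, ← ENNReal.tsum_mul_left,
    ← ENNReal.tsum_mul_left, ← ENNReal.tsum_add]
  refine ENNReal.tsum_le_tsum fun n => ?_
  have h := setLIntegral_Ω3_enorm_sq_mul_le hW hWi hN.ne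
    (ψ := fun x => ψ (x + latticeVec n)) (by fun_prop)
    (hs.comp_homeomorph (Homeomorph.addRight (latticeVec n)))
  have hWn : ∀ x, W (x + latticeVec n) = W x := fun x => hper x n
  simpa only [fderiv_comp_add_right, hWn] using h
end
end
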